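/- arXiv:2002.12672 — 2 statements merged into one kernel-verified Lean document; each statement's English description precedes it below -/
import Mathlib

section
/- Let a(z) = (1+z)/2 and b₀(z) = z(1−z)/2. Then M(a) is a closed subspace of the de Branges–Rovnyak space H(b₀) of codimension one, and H(b₀) = M(a) ⊕ ℂ·k₋₁^{b₀}, where k₋₁^{b₀}(z) = (1 − conj(b₀(−1)) b₀(z))/(1+z) = (2−z)/2. -/
open Complex MeasureTheory Filter Set

noncomputable section

/-! ### Basic framework: Hardy spaces on the unit disk via boundary values -/

/-- The open unit disk in the complex plane. -/
def unitDisk : Set ℂ := Metric.ball 0 1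

/-- The point `e^{iθ}` of the unit circle. -/
def uc (θ : ℝ) : ℂ := Complex.exp ((θ : ℂ) * Complex.I)

/-- Lebesgue measure on the parameter interval `(0, 2π]` of the unit circle. -/
def bMeasure : Measure ℝ := volume.restrict (Set.Ioc 0 (2 * Real.pi))

/-- Radial limit of `f` at the boundary point `w` (`|w| = 1`). -/
def radLim (f : ℂ → ℂ) (w : ℂ) : ℂ :=
  limUnder (nhdsWithin (1 : ℝ) (Set.Iio 1)) fun r : ℝ => f ((r : ℂ) * w)

/-- The boundary value function of `f` on the unit circle. -/
def bdry (f : ℂ → ℂ) (θ : ℝ) : ℂ := radLim f (uc θ)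

/-- Membership in the Hardy space `H²` of the unit disk. -/
def MemH2 (f : ℂ → ℂ) : Prop :=
  DifferentiableOn ℂ f unitDisk ∧
    ∃ C : ℝ, ∀ r ∈ Set.Ico (0 : ℝ) 1,
      (∫ θ in (0:ℝ)..(2 * Real.pi), ‖f ((r : ℂ) * uc θ)‖ ^ 2) ≤ C

/-- Membership in the Hardy space `H¹` of the unit disk. -/
def MemH1 (f : ℂ → ℂ) : Prop :=
  DifferentiableOn ℂ f unitDisk ∧
    ∃ C : ℝ, ∀ r ∈ Set.Ico (0 : ℝ) 1,
      (∫ θ in (0:ℝ)..(2 * Real.pi), ‖f ((r : ℂ) * uc θ)‖) ≤ C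

/-- Membership in `H^∞` (bounded holomorphic functions on the disk). -/
def MemHinf (f : ℂ → ℂ) : Prop :=
  DifferentiableOn ℂ f unitDisk ∧ ∃ C : ℝ, ∀ z ∈ unitDisk, ‖f z‖ ≤ C

/-- The `H²` (normalized boundary `L²`) inner product `⟨f, g⟩`. -/
def bInner (f g : ℂ → ℂ) : ℂ :=
  (1 / (2 * (Real.pi : ℂ))) *
    ∫ θ in (0:ℝ)..(2 * Real.pi), bdry f θ * (starRingEnd ℂ) (bdry g θ)

/-- The squared `H²` norm, computed on the boundary. -/
def bNormSq (f : ℂ → ℂ) : ℝ :=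
  (1 / (2 * Real.pi)) * ∫ θ in (0:ℝ)..(2 * Real.pi), ‖bdry f θ‖ ^ 2

/-- `f` is an inner function. -/
def IsInner (f : ℂ → ℂ) : Prop :=
  DifferentiableOn ℂ f unitDisk ∧ (∀ z ∈ unitDisk, ‖f z‖ ≤ 1) ∧
    ∀ᵐ θ ∂bMeasure, ‖bdry f θ‖ = 1

/-- `f` is an outer function: it is, up to a unimodular constant, the Herglotz
exponential of the Poisson integral of `log |f*|`. -/
def IsOuter (f : ℂ → ℂ) : Prop :=
  DifferentiableOn ℂ f unitDisk ∧ ∃ c : ℂ, ‖c‖ = 1 ∧ ∀ z ∈ unitDisk,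
    f z = c * Complex.exp ((1 / (2 * (Real.pi : ℂ))) *
      ∫ θ in (0:ℝ)..(2 * Real.pi),
        ((uc θ + z) / (uc θ - z)) * ((Real.log ‖bdry f θ‖ : ℝ) : ℂ))

/-- `b` is a nonextreme point of the closed unit ball of `H^∞`:
`log (1 - |b|)` is integrable on the circle. -/
def Nonextreme (b : ℂ → ℂ) : Prop :=
  DifferentiableOn ℂ b unitDisk ∧ (∀ z ∈ unitDisk, ‖b z‖ ≤ 1) ∧
    Integrable (fun θ => Real.log (1 - ‖bdry b θ‖)) bMeasure

/-- `(b, a)` is a pair: `b` nonextreme, `a` outer, `|a|² + |b|² = 1` a.e. on the circle. -/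
def IsPair (b a : ℂ → ℂ) : Prop :=
  Nonextreme b ∧ IsOuter a ∧
    ∀ᵐ θ ∂bMeasure, ‖bdry a θ‖ ^ 2 + ‖bdry b θ‖ ^ 2 = 1

/-- `(b, a)` is the pair associated with the outer function `f` of unit `H²` norm:
`f = a / (1 - b)`. -/
def PairAssoc (f b a : ℂ → ℂ) : Prop :=
  IsOuter f ∧ MemH2 f ∧ bNormSq f = 1 ∧ IsPair b a ∧
    ∀ z ∈ unitDisk, f z = a z / (1 - b z)

/-- The Herglotz measure `μ_λ` of `(1 + λ̄b)/(1 − λ̄b)` is absolutely continuous: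
the Herglotz representation holds with density `|a/(1 − λ̄b)|²` and no singular part. -/
def HerglotzAC (b a : ℂ → ℂ) (lam : ℂ) : Prop :=
  ∀ z ∈ unitDisk,
    (1 + (starRingEnd ℂ) lam * b z) / (1 - (starRingEnd ℂ) lam * b z) =
      (1 / (2 * (Real.pi : ℂ))) *
        (∫ θ in (0:ℝ)..(2 * Real.pi),
          ((1 + (uc θ)⁻¹ * z) / (1 - (uc θ)⁻¹ * z)) *
            ((‖bdry (fun w => a w / (1 - (starRingEnd ℂ) lam * b w)) θ‖ ^ 2 : ℝ) : ℂ)) +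
      Complex.I *
        ((((1 + (starRingEnd ℂ) lam * b 0) / (1 - (starRingEnd ℂ) lam * b 0)).im : ℝ) : ℂ)

/-- The pair `(b, a)` is special: the Herglotz measure of `(1+b)/(1−b)` is
absolutely continuous. -/
def SpecialPair (b a : ℂ → ℂ) : Prop := IsPair b a ∧ HerglotzAC b a 1

/-- `F ∈ H¹` is rigid: the only functions of `H¹` with the same argument a.e. on the
circle are the positive scalar multiples of `F`. -/
def Rigid (F : ℂ → ℂ) : Prop :=
  MemH1 F ∧ ∀ G : ℂ → ℂ, MemH1 G →
    (∀ᵐ θ ∂bMeasure, ∃ t : ℝ, 0 < t ∧ bdry G θ = (t : ℂ) * bdry F θ) →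
    ∃ c : ℝ, 0 < c ∧ ∀ z ∈ unitDisk, G z = (c : ℂ) * F z

/-- The Riesz (analytic) projection `P₊` of a boundary function, realized through the
Szegő integral: `(P₊u)(z) = (1/2π) ∫ u(θ) (1 − z e^{-iθ})⁻¹ dθ`. -/
def szProj (u : ℝ → ℂ) : ℂ → ℂ := fun z =>
  (1 / (2 * (Real.pi : ℂ))) *
    ∫ θ in (0:ℝ)..(2 * Real.pi), u θ * (1 - z * (uc θ)⁻¹)⁻¹

/-- The Toeplitz operator with boundary symbol `φ`: `T_φ h = P₊(φ · h*)`. -/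
def toeplitz (φ : ℝ → ℂ) (h : ℂ → ℂ) : ℂ → ℂ := szProj fun θ => φ θ * bdry h θ

/-- The kernel of the Toeplitz operator `T_φ`, as a subset of `H²`. -/
def toeplitzKer (φ : ℝ → ℂ) : Set (ℂ → ℂ) :=
  {h | MemH2 h ∧ ∀ z ∈ unitDisk, toeplitz φ h z = 0}

/-- The boundary symbol `ḡ` of a function `g` on the disk. -/
def conjBdry (g : ℂ → ℂ) : ℝ → ℂ := fun θ => (starRingEnd ℂ) (bdry g θ)

/-- The boundary symbol `ḡ/g`. -/
def symbQuot (g : ℂ → ℂ) : ℝ → ℂ := fun θ => (starRingEnd ℂ) (bdry g θ) / bdry g θ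

/-- The boundary symbol `Ī f̄ / f`. -/
def symbIf (I f : ℂ → ℂ) : ℝ → ℂ :=
  fun θ => (starRingEnd ℂ) (bdry I θ) * (starRingEnd ℂ) (bdry f θ) / bdry f θ

/-- The model space `K_I = H² ⊖ I H² = ker T_Ī` of an inner function `I`. -/
def modelSpace (I : ℂ → ℂ) : Set (ℂ → ℂ) := toeplitzKer (conjBdry I)

/-- The set `f·K_I`. -/
def fModel (f I : ℂ → ℂ) : Set (ℂ → ℂ) :=
  {g | ∃ h ∈ modelSpace I, ∀ z ∈ unitDisk, g z = f z * h z}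

/-- The orthogonal complement `ker T_{Ī f̄/f} ⊖ f·K_I` of `f·K_I` in the kernel of
`T_{Ī f̄/f}`, with respect to the `H²` inner product. -/
def kerPerp (I f : ℂ → ℂ) : Set (ℂ → ℂ) :=
  {h | h ∈ toeplitzKer (symbIf I f) ∧ ∀ g ∈ fModel f I, bInner h g = 0}

/-- `M(a) = T_a H² = a·H²` (for `a ∈ H^∞`), the range of `T_a`, as a set. -/
def rangeMa (a : ℂ → ℂ) : Set (ℂ → ℂ) :=
  {g | ∃ h, MemH2 h ∧ ∀ z ∈ unitDisk, g z = a z * h z}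

/-- Membership in the de Branges–Rovnyak space `H(b)` for nonextreme `b` with
pair `(b, a)`:  `h ∈ H(b)` iff `h ∈ H²` and `T_b̄ h = T_ā h⁺` for some `h⁺ ∈ H²`
(Sarason's characterization). -/
def MemHb (b a h : ℂ → ℂ) : Prop :=
  MemH2 h ∧ ∃ h' : ℂ → ℂ, MemH2 h' ∧
    ∀ z ∈ unitDisk, toeplitz (conjBdry b) h z = toeplitz (conjBdry a) h' z

/-- The function `h⁺ ∈ H²` with `T_b̄ h = T_ā h⁺` (unique when it exists, since `a`
is outer). -/
def plusFun (b a h : ℂ → ℂ) : ℂ → ℂ :=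
  Classical.epsilon fun h' : ℂ → ℂ => MemH2 h' ∧
    ∀ z ∈ unitDisk, toeplitz (conjBdry b) h z = toeplitz (conjBdry a) h' z

/-- The inner product of `H(b)`: `⟨h, g⟩_b = ⟨h, g⟩₂ + ⟨h⁺, g⁺⟩₂`. -/
def hbInner (b a h g : ℂ → ℂ) : ℂ :=
  bInner h g + bInner (plusFun b a h) (plusFun b a g)

/-- The squared norm of `H(b)`. -/
def hbNormSq (b a h : ℂ → ℂ) : ℝ := (hbInner b a h h).re

/-- The closure of a set `S` in the norm of `H(b)`. -/
def hbClosure (b a : ℂ → ℂ) (S : Set (ℂ → ℂ)) : Set (ℂ → ℂ) :=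
  {h | MemHb b a h ∧ ∀ ε : ℝ, 0 < ε → ∃ g ∈ S,
    hbNormSq b a (fun z => h z - g z) < ε}

/-- The orthogonal complement of `S` in `H(b)`. -/
def hbPerp (b a : ℂ → ℂ) (S : Set (ℂ → ℂ)) : Set (ℂ → ℂ) :=
  {h | MemHb b a h ∧ ∀ g ∈ S, hbInner b a h g = 0}

/-- A set of functions on the disk is a `k`-dimensional linear subspace. -/
def HasDimOn (S : Set (ℂ → ℂ)) (k : ℕ) : Prop :=
  ∃ g : Fin k → (ℂ → ℂ), (∀ j, g j ∈ S) ∧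
    (∀ c : Fin k → ℂ, (∀ z ∈ unitDisk, (∑ j, c j * g j z) = 0) → c = 0) ∧
    ∀ h ∈ S, ∃ c : Fin k → ℂ, ∀ z ∈ unitDisk, h z = ∑ j, c j * g j z

/-- The Szegő kernel `k_w(z) = (1 - w̄ z)⁻¹` of `H²`. -/
def szKernel (w z : ℂ) : ℂ := (1 - (starRingEnd ℂ) w * z)⁻¹

/-- The reproducing kernel of `H(b)` at an interior point `w ∈ 𝔻`. -/
def hbKernel (b : ℂ → ℂ) (w z : ℂ) : ℂ :=
  (1 - (starRingEnd ℂ) (b w) * b z) / (1 - (starRingEnd ℂ) w * z)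

/-- The boundary kernel of `H(b)` at a boundary point `z₀`, defined through the
nontangential limit `b(z₀) = radLim b z₀`. -/
def hbBoundaryKernel (b : ℂ → ℂ) (z₀ z : ℂ) : ℂ :=
  (1 - (starRingEnd ℂ) (radLim b z₀) * b z) / (1 - (starRingEnd ℂ) z₀ * z)

/-- `u` is a nontangential approach sequence to the boundary point `z₀`. -/
def NTApproach (u : ℕ → ℂ) (z₀ : ℂ) : Prop :=
  (∀ n, u n ∈ unitDisk) ∧ Filter.Tendsto u Filter.atTop (nhds z₀) ∧
    ∃ M : ℝ, ∀ n, ‖u n - z₀‖ ≤ M * (1 - ‖u n‖)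

/-- `b` has an angular derivative in the sense of Carathéodory at `z₀ ∈ ∂𝔻`. -/
def HasADC (b : ℂ → ℂ) (z₀ : ℂ) : Prop :=
  ‖radLim b z₀‖ = 1 ∧ ∃ L : ℂ, ∀ u : ℕ → ℂ, NTApproach u z₀ →
    Filter.Tendsto (fun n => b (u n)) Filter.atTop (nhds (radLim b z₀)) ∧
    Filter.Tendsto (fun n => (b (u n) - radLim b z₀) / (u n - z₀)) Filter.atTop (nhds L)

lemma norm_uc (θ : ℝ) : ‖uc θ‖ = 1 := by simp [uc, Complex.norm_exp_ofReal_mul_I]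

lemma uc_ne_zero (θ : ℝ) : uc θ ≠ 0 := by simp [uc]

lemma continuous_uc : Continuous uc := by unfold uc; fun_prop

lemma hasDerivAt_uc (θ : ℝ) : HasDerivAt uc (uc θ * I) θ := by
  have h : HasDerivAt (fun t : ℝ => (t : ℂ) * I) (1 * I) θ :=
    (Complex.ofRealCLM.hasDerivAt (x := θ)).mul_const I
  rw [one_mul] at h
  exact h.cexp

lemma integral_poissonKernel {r : ℝ} (h0 : 0 ≤ r) (h1 : r < 1) :
    ∫ θ in (0:ℝ)..(2 * Real.pi), (1 - r ^ 2) / ‖uc θ - r‖ ^ 2 = 2 * Real.pi := by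
  have hw : (r : ℂ) ∈ Metric.ball (0 : ℂ) 1 := by simpa [abs_of_nonneg h0] using h1
  have h := (diffContOnCl_const (𝕜 := ℂ) (c := (1 : ℂ)) (s := Metric.ball 0 1)
    ).circleAverage_poissonKernel_smul hw
  have h2 : (2 * Real.pi)⁻¹ * ∫ θ in (0:ℝ)..(2 * Real.pi), (1 - r ^ 2) / ‖uc θ - r‖ ^ 2 = 1 := by
    have h3 : (((2 * Real.pi)⁻¹ * ∫ θ in (0:ℝ)..(2 * Real.pi),
        (1 - r ^ 2) / ‖uc θ - r‖ ^ 2 : ℝ) : ℂ) = 1 := by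
      rw [← h, Real.circleAverage]
      rw [Complex.ofReal_mul, ← intervalIntegral.integral_ofReal, Complex.real_smul]
      congr 1
      refine intervalIntegral.integral_congr fun θ _ => ?_
      simp [poissonKernel, circleMap, uc, Complex.norm_exp_ofReal_mul_I]
    exact_mod_cast h3
  field_simp at h2
  linarith

lemma circleIntegral_sub_sq_inv_mul {H : ℂ → ℂ} (hH : DiffContOnCl ℂ H (Metric.ball 0 1))
    {z : ℂ} (hz : z ∈ Metric.ball (0 : ℂ) 1) :
    ∮ ζ in C(0, 1), ((ζ - z) ^ 2)⁻¹ * H ζ = 2 * Real.pi * I * deriv H z := by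
  have hzn : Metric.closedBall (0 : ℂ) 1 ∈ nhds z :=
    Filter.mem_of_superset (Metric.isOpen_ball.mem_nhds hz) Metric.ball_subset_closedBall
  have hd : DifferentiableAt ℂ H z := hH.differentiableAt Metric.isOpen_ball hz
  have h1 := Complex.circleIntegral_sub_inv_smul_of_differentiable_on_off_countable
    (f := dslope H z) (Set.countable_singleton z) hz
    ((continuousOn_dslope hzn).2 ⟨hH.continuousOn_ball, hd⟩) (fun x hx => by
      have hxz : x ≠ z := fun h => hx.2 (by simp [h])
      exact (differentiableAt_dslope_of_ne hxz).2
        (hH.differentiableAt Metric.isOpen_ball hx.1))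
  rw [dslope_same, smul_eq_mul] at h1
  rw [← h1]
  have hne : ∀ ζ ∈ Metric.sphere (0 : ℂ) 1, ζ - z ≠ 0 := fun ζ hζ h => by
    rw [sub_eq_zero] at h
    subst h
    simp at hz hζ
    linarith
  have h2 := circleIntegral.integral_sub_zpow_of_ne (n := -2) (by norm_num) 0 z 1
  have hz' : z ∉ Metric.sphere (0 : ℂ) |1| := fun h => hne z (by simpa using h) (by simp)
  have hc : CircleIntegrable (fun ζ => ((ζ - z) ^ 2)⁻¹ * H ζ) 0 1 := by
    refine ContinuousOn.circleIntegrable zero_le_one ?_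
    refine ContinuousOn.mul (ContinuousOn.inv₀ (by fun_prop) fun ζ hζ => pow_ne_zero _ (hne ζ hζ)) ?_
    exact hH.continuousOn_ball.mono Metric.sphere_subset_closedBall
  have hc2 : CircleIntegrable (fun ζ => H z * (ζ - z) ^ (-2 : ℤ)) 0 1 := by
    refine ContinuousOn.circleIntegrable zero_le_one ?_
    refine ContinuousOn.mul (by fun_prop) ?_
    exact ContinuousOn.zpow₀ (by fun_prop) _ fun ζ hζ => Or.inl (hne ζ hζ)
  have h3 : ∮ ζ in C(0, 1), (((ζ - z) ^ 2)⁻¹ * H ζ - H z * (ζ - z) ^ (-2 : ℤ)) =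
      ∮ ζ in C(0, 1), ((ζ - z) ^ 2)⁻¹ * H ζ := by
    rw [circleIntegral.integral_sub hc hc2, circleIntegral.integral_const_mul, h2]
    simp
  rw [← h3]
  refine circleIntegral.integral_congr zero_le_one fun ζ hζ => ?_
  have := hne ζ hζ
  have hne' : ζ ≠ z := fun h => this (by simp [h])
  simp only [dslope_of_ne _ hne', slope, smul_eq_mul, vsub_eq_sub]
  have : (ζ - z) ^ (-2 : ℤ) = ((ζ - z) ^ 2)⁻¹ := by
    rw [zpow_neg]; norm_cast
  rw [this]
  field_simp

lemma normSq_sub_real {ζ : ℂ} (hζ : ‖ζ‖ = 1) (c : ℝ) :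
    ‖ζ - c‖ ^ 2 = 1 - 2 * c * ζ.re + c ^ 2 := by
  have h : ζ.re * ζ.re + ζ.im * ζ.im = 1 := by
    rw [← Complex.normSq_apply, Complex.normSq_eq_norm_sq, hζ]; norm_num
  rw [← Complex.normSq_eq_norm_sq, Complex.normSq_apply]
  simp
  nlinarith

/-- The difference of the Cauchy kernels (for the derivative) at `r` and at its mirror image
`2 - r` is dominated by the Poisson kernel. -/
lemma norm_mul_cauchyKernel_sub_le {ζ : ℂ} (hζ : ‖ζ‖ = 1) {r η C : ℝ} (hr : 1 / 2 ≤ r) (hr1 : r < 1)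
    (hη : 0 ≤ η) (hC : 0 ≤ C) {x : ℂ} (hx : ‖x‖ ≤ η * ‖ζ - 1‖ + C * ‖ζ - 1‖ ^ 4) :
    ‖(((ζ - r) ^ 2)⁻¹ - ((ζ - (2 - r : ℝ)) ^ 2)⁻¹) * x‖ ≤
      8 * η * ((1 - r ^ 2) / ‖ζ - r‖ ^ 2) + 32 * C * (1 - r) := by
  have hre : ζ.re ≤ 1 := (Complex.re_le_norm ζ).trans hζ.le
  have hre' : -1 ≤ ζ.re := by
    have := (abs_le.1 (Complex.abs_re_le_norm ζ)).1; rwa [hζ] at this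
  have hA := normSq_sub_real hζ r
  have hB := normSq_sub_real hζ (2 - r)
  have hW := normSq_sub_real hζ 1
  rw [Complex.ofReal_one] at hW
  set A := ‖ζ - r‖ ^ 2 with hAdef
  have hApos : 0 < A := by rw [hA]; nlinarith
  have hBA : A ≤ ‖ζ - (2 - r : ℝ)‖ ^ 2 := by rw [hA, hB]; nlinarith
  set w := ‖ζ - 1‖ with hw
  have hw0 : 0 ≤ w := norm_nonneg _
  have hwA : w ^ 2 ≤ 2 * A := by rw [hW, hA]; nlinarith
  have hw2 : w ≤ 2 := by nlinarith
  have hn1 : ζ - r ≠ 0 := fun h => by rw [hAdef, h] at hApos; simp at hApos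
  have hn2 : ζ - (2 - r : ℝ) ≠ 0 := fun h => by rw [h] at hBA; simp at hBA; linarith
  have hK : ((ζ - r) ^ 2)⁻¹ - ((ζ - (2 - r : ℝ)) ^ 2)⁻¹ =
      -4 * ((1 - r : ℝ) : ℂ) * (ζ - 1) / ((ζ - r) ^ 2 * (ζ - (2 - r : ℝ)) ^ 2) := by
    field_simp
    push_cast
    ring
  have hKn : ‖((ζ - r) ^ 2)⁻¹ - ((ζ - (2 - r : ℝ)) ^ 2)⁻¹‖ ≤ 4 * (1 - r) * w / A ^ 2 := by
    rw [hK, norm_div, norm_mul, norm_mul, norm_mul, norm_pow, norm_pow, ← hAdef, ← hw,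
      Complex.norm_real, Real.norm_of_nonneg (by linarith : (0:ℝ) ≤ 1 - r)]
    have : ‖(-4 : ℂ)‖ = 4 := by simp
    rw [this]
    have h1r : 0 < 1 - r := by linarith
    rw [sq A]
    gcongr
  rw [norm_mul]
  have h1r : 0 < 1 - r := by linarith
  calc _ ≤ (4 * (1 - r) * w / A ^ 2) * (η * w + C * w ^ 4) := by gcongr
    _ = 4 * η * (1 - r) * (w ^ 2 / A ^ 2) + 4 * C * (1 - r) * w * (w ^ 4 / A ^ 2) := by ring
    _ ≤ 4 * η * (1 - r) * (2 / A) + 4 * C * (1 - r) * 2 * 4 := by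
        have e1 : w ^ 2 / A ^ 2 ≤ 2 / A := by
          rw [div_le_div_iff₀ (by positivity) hApos]; nlinarith
        have e2 : w ^ 4 / A ^ 2 ≤ 4 := by
          rw [div_le_iff₀ (by positivity)]; nlinarith [sq_nonneg w]
        gcongr
    _ ≤ _ := by
        have e3 : (1 - r) / A ≤ (1 - r ^ 2) / A := by gcongr; nlinarith
        have := mul_le_mul_of_nonneg_left e3 hη
        have e4 : 4 * η * (1 - r) * (2 / A) = 8 * (η * ((1 - r) / A)) := by ring
        rw [e4]
        nlinarith

lemma norm_deriv_le_of_boundary_bound {H : ℂ → ℂ} (hH : DiffContOnCl ℂ H (Metric.ball 0 1))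
    {r η C : ℝ} (hr : 1 / 2 ≤ r) (hr1 : r < 1) (hη : 0 ≤ η) (hC : 0 ≤ C)
    (hb : ∀ ζ : ℂ, ‖ζ‖ = 1 → ‖H ζ‖ ≤ η * ‖ζ - 1‖ + C * ‖ζ - 1‖ ^ 4) :
    ‖deriv H r‖ ≤ 8 * η + 32 * C * (1 - r) := by
  have hrb : (r : ℂ) ∈ Metric.ball (0 : ℂ) 1 := by
    simpa [abs_of_nonneg (by linarith : (0:ℝ) ≤ r)] using hr1
  have h1 := circleIntegral_sub_sq_inv_mul hH hrb
  have hn2 : ∀ ζ ∈ Metric.closedBall (0 : ℂ) 1, ζ - (2 - r : ℝ) ≠ 0 := fun ζ hζ h => by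
    rw [sub_eq_zero] at h
    rw [h, mem_closedBall_zero_iff, Complex.norm_real, Real.norm_of_nonneg (by linarith)] at hζ
    linarith
  have hn1 : ∀ ζ ∈ Metric.sphere (0 : ℂ) 1, ζ - r ≠ 0 := fun ζ hζ h => by
    rw [sub_eq_zero] at h
    rw [h, mem_sphere_zero_iff_norm, Complex.norm_real, Real.norm_of_nonneg (by linarith)] at hζ
    linarith
  have hHc := hH.continuousOn_ball
  have hc2 : ContinuousOn (fun ζ : ℂ => ((ζ - (2 - r : ℝ)) ^ 2)⁻¹ * H ζ) (Metric.closedBall 0 1) :=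
    ContinuousOn.mul (ContinuousOn.inv₀ (by fun_prop) fun ζ hζ => pow_ne_zero _ (hn2 ζ hζ)) hHc
  have hc1 : ContinuousOn (fun ζ : ℂ => ((ζ - r) ^ 2)⁻¹ * H ζ) (Metric.sphere 0 1) :=
    ContinuousOn.mul (ContinuousOn.inv₀ (by fun_prop) fun ζ hζ => pow_ne_zero _ (hn1 ζ hζ))
      (hHc.mono Metric.sphere_subset_closedBall)
  have h2 : ∮ ζ in C(0, 1), ((ζ - (2 - r : ℝ)) ^ 2)⁻¹ * H ζ = 0 := by
    refine Complex.circleIntegral_eq_zero_of_differentiable_on_off_countable zero_le_one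
      Set.countable_empty hc2 fun z hz => ?_
    have := hn2 z (Metric.ball_subset_closedBall hz.1)
    have hd := hH.differentiableAt Metric.isOpen_ball hz.1
    exact DifferentiableAt.mul (DifferentiableAt.inv (by fun_prop) (pow_ne_zero _ this)) hd
  have h3 : ∮ ζ in C(0, 1), (((ζ - r) ^ 2)⁻¹ - ((ζ - (2 - r : ℝ)) ^ 2)⁻¹) * H ζ =
      2 * Real.pi * I * deriv H r := by
    simp_rw [sub_mul]
    rw [circleIntegral.integral_sub (hc1.circleIntegrable zero_le_one)
      ((hc2.mono Metric.sphere_subset_closedBall).circleIntegrable zero_le_one), h1, h2, sub_zero]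
  have h4 : ‖∮ ζ in C(0, 1), (((ζ - r) ^ 2)⁻¹ - ((ζ - (2 - r : ℝ)) ^ 2)⁻¹) * H ζ‖ ≤
      ∫ θ in (0:ℝ)..(2 * Real.pi), (8 * η * ((1 - r ^ 2) / ‖uc θ - r‖ ^ 2) + 32 * C * (1 - r)) := by
    unfold circleIntegral
    refine intervalIntegral.norm_integral_le_of_norm_le Real.two_pi_pos.le ?_ ?_
    · refine ae_of_all _ fun θ _ => ?_
      have hu : circleMap 0 1 θ = uc θ := by simp [circleMap, uc]
      rw [deriv_circleMap, hu, norm_smul, norm_mul, norm_uc, Complex.norm_I, one_mul, one_mul]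
      exact norm_mul_cauchyKernel_sub_le (norm_uc θ) hr hr1 hη hC (hb _ (norm_uc θ))
    · refine Continuous.intervalIntegrable ?_ _ _
      have := continuous_uc
      have h0 : ∀ θ, ‖uc θ - r‖ ^ 2 ≠ 0 := fun θ =>
        pow_ne_zero _ (norm_ne_zero_iff.2 (hn1 _ (by simp [norm_uc])))
      fun_prop (disch := exact h0 _)
  have hi : IntervalIntegrable (fun θ => (1 - r ^ 2) / ‖uc θ - r‖ ^ 2) volume 0 (2 * Real.pi) := by
    refine Continuous.intervalIntegrable ?_ _ _
    have := continuous_uc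
    have h0 : ∀ θ, ‖uc θ - r‖ ^ 2 ≠ 0 := fun θ =>
      pow_ne_zero _ (norm_ne_zero_iff.2 (hn1 _ (by simp [norm_uc])))
    fun_prop (disch := exact h0 _)
  rw [intervalIntegral.integral_add (hi.const_mul _) (by simp),
    intervalIntegral.integral_const_mul, integral_poissonKernel (by linarith) hr1, h3] at h4
  simp only [norm_mul, Complex.norm_real, Complex.norm_I, intervalIntegral.integral_const,
    smul_eq_mul, Complex.norm_ofNat, Real.norm_of_nonneg Real.pi_pos.le] at h4
  have := Real.pi_pos
  have h5 : (2 * Real.pi) * ‖deriv H r‖ ≤ (2 * Real.pi) * (8 * η + 32 * C * (1 - r)) := by linarith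
  exact le_of_mul_le_mul_left h5 (by positivity)

lemma tendsto_deriv_radial_of_boundary {H : ℂ → ℂ} (hH : DiffContOnCl ℂ H (Metric.ball 0 1))
    (h : ∀ η > 0, ∃ δ > 0, ∀ ζ : ℂ, ‖ζ‖ = 1 → ‖ζ - 1‖ < δ → ‖H ζ‖ ≤ η * ‖ζ - 1‖) :
    Tendsto (fun r : ℝ => deriv H r) (nhdsWithin 1 (Set.Iio 1)) (nhds 0) := by
  obtain ⟨M, hM⟩ := (isCompact_closedBall (0 : ℂ) 1).exists_bound_of_continuousOn
    hH.continuousOn_ball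
  have hM0 : 0 ≤ M := (norm_nonneg _).trans (hM 0 (by simp))
  rw [tendsto_zero_iff_norm_tendsto_zero, Metric.tendsto_nhds]
  intro ε hε
  obtain ⟨δ, hδ, hb⟩ := h (ε / 16) (by positivity)
  have hC0 : 0 ≤ M / δ ^ 4 := by positivity
  have hbound : ∀ ζ : ℂ, ‖ζ‖ = 1 →
      ‖H ζ‖ ≤ ε / 16 * ‖ζ - 1‖ + M / δ ^ 4 * ‖ζ - 1‖ ^ 4 := fun ζ hζ => by
    rcases lt_or_ge ‖ζ - 1‖ δ with hlt | hge
    · exact (hb ζ hζ hlt).trans (le_add_of_nonneg_right (by positivity))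
    · have h1 := hM ζ (by simp [hζ])
      have h2 : M ≤ M / δ ^ 4 * ‖ζ - 1‖ ^ 4 := by
        rw [div_mul_eq_mul_div, le_div_iff₀ (by positivity)]
        gcongr
      have : 0 ≤ ε / 16 * ‖ζ - 1‖ := by positivity
      linarith
  have ht : Tendsto (fun r : ℝ => 8 * (ε / 16) + 32 * (M / δ ^ 4) * (1 - r))
      (nhdsWithin 1 (Set.Iio 1)) (nhds (8 * (ε / 16) + 32 * (M / δ ^ 4) * (1 - 1))) :=
    ((Continuous.tendsto (by fun_prop) 1).mono_left nhdsWithin_le_nhds)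
  have ht' := ht.eventually_lt_const (u := ε) (by linarith)
  have hmem : ∀ᶠ r : ℝ in nhdsWithin 1 (Set.Iio 1), 1 / 2 ≤ r :=
    nhdsWithin_le_nhds (eventually_ge_nhds (by norm_num))
  filter_upwards [ht', self_mem_nhdsWithin, hmem] with r h1 h2 h3
  rw [dist_zero_right, norm_norm]
  exact (norm_deriv_le_of_boundary_bound hH h3 h2 (by positivity) hC0 hbound).trans_lt h1

/-- Fatou's theorem in differentiated form: where the boundary function of `Ψ` is differentiable
along the circle, `Ψ'` has the corresponding radial limit. -/
lemma tendsto_deriv_radial {Ψ : ℂ → ℂ} (hΨ : DiffContOnCl ℂ Ψ (Metric.ball 0 1)) {θ₀ : ℝ} {l : ℂ}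
    (h : HasDerivAt (fun θ => Ψ (uc θ)) (I * uc θ₀ * l) θ₀) :
    Tendsto (fun r : ℝ => deriv Ψ (r * uc θ₀)) (nhdsWithin 1 (Set.Iio 1)) (nhds l) := by
  set H : ℂ → ℂ := fun ζ => Ψ (uc θ₀ * ζ) - Ψ (uc θ₀) - l * uc θ₀ * (ζ - 1) with hHdef
  have hu := norm_uc θ₀
  have hmaps : Set.MapsTo (fun ζ => uc θ₀ * ζ) (Metric.ball 0 1) (Metric.ball 0 1) :=
    fun ζ hζ => by simpa [hu] using hζ
  have hcomp : DiffContOnCl ℂ (fun ζ => Ψ (uc θ₀ * ζ)) (Metric.ball 0 1) :=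
    hΨ.comp (Differentiable.diffContOnCl (by fun_prop)) hmaps
  have hH : DiffContOnCl ℂ H (Metric.ball 0 1) :=
    (hcomp.sub_const _).sub (Differentiable.diffContOnCl (by fun_prop))
  have hG : HasDerivAt (fun t : ℝ => H (uc t)) 0 0 := by
    have h1 : HasDerivAt (fun t : ℝ => Ψ (uc (θ₀ + t))) (I * uc θ₀ * l) 0 := by
      have h' : HasDerivAt (fun θ => Ψ (uc θ)) (I * uc θ₀ * l) (θ₀ + 0) := by simpa using h
      exact h'.comp_const_add θ₀ 0
    have h2 := ((h1.sub_const (Ψ (uc θ₀))).sub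
      (((hasDerivAt_uc 0).sub_const 1).const_mul (l * uc θ₀)))
    have h0 : uc 0 = 1 := by simp [uc]
    have he : (fun t : ℝ => H (uc t)) =
        (fun t : ℝ => Ψ (uc (θ₀ + t)) - Ψ (uc θ₀)) - fun t => l * uc θ₀ * (uc t - 1) := by
      funext t
      simp only [hHdef, Pi.sub_apply]
      congr 3
      simp [uc, ← Complex.exp_add, add_mul]
    have hv : I * uc θ₀ * l - l * uc θ₀ * (uc 0 * I) = 0 := by rw [h0]; ring
    rw [hv] at h2
    rw [he]
    exact h2
  have hH1 : H 1 = 0 := by simp [hHdef]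
  have key := tendsto_deriv_radial_of_boundary hH (by
    intro η hη
    have h0 : uc 0 = 1 := by simp [uc]
    have hlo := (hasDerivAt_iff_isLittleO_nhds_zero.1 hG)
    simp only [zero_add, h0, hH1, sub_zero, smul_zero] at hlo
    have hev := hlo.bound (show 0 < η / Real.pi by positivity)
    have harg : ContinuousAt Complex.arg 1 := Complex.continuousAt_arg (by simp)
    have hev2 : ∀ᶠ ζ in nhds (1 : ℂ), ‖H (uc ζ.arg)‖ ≤ η / Real.pi * ‖ζ.arg‖ := by
      have : Tendsto Complex.arg (nhds 1) (nhds 0) := by simpa using harg.tendsto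
      exact this.eventually hev
    obtain ⟨δ, hδ, hball⟩ := Metric.eventually_nhds_iff.1 hev2
    refine ⟨δ, hδ, fun ζ hζ hlt => ?_⟩
    have h1 := hball (show dist ζ 1 < δ by rwa [dist_eq_norm])
    have h2 : uc ζ.arg = ζ := by
      have := Complex.norm_mul_exp_arg_mul_I ζ
      rw [hζ] at this
      simpa [uc] using this
    rw [h2] at h1
    have hζ0 : ζ ≠ 0 := fun h => by simp [h] at hζ
    have h3 : |ζ.arg| ≤ Real.pi / 2 * ‖ζ - 1‖ := by
      have := Complex.angle_le_mul_norm_sub (x := 1) (y := ζ) (by simp) hζ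
      rwa [Complex.angle_one_left hζ0, norm_sub_rev] at this
    have hpi := Real.pi_pos
    calc _ ≤ _ := h1
      _ ≤ η / Real.pi * (Real.pi / 2 * ‖ζ - 1‖) := by
          rw [Real.norm_eq_abs]; gcongr
      _ = η / 2 * ‖ζ - 1‖ := by field_simp
      _ ≤ _ := by gcongr; linarith)
  have hder : ∀ᶠ r : ℝ in nhdsWithin 1 (Set.Iio 1),
      (uc θ₀)⁻¹ * deriv H r + l = deriv Ψ (r * uc θ₀) := by
    have hmem : ∀ᶠ r : ℝ in nhdsWithin 1 (Set.Iio 1), 0 < r :=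
      nhdsWithin_le_nhds (eventually_gt_nhds (by norm_num))
    filter_upwards [self_mem_nhdsWithin, hmem] with r hr1 hr0
    have hz : uc θ₀ * (r : ℂ) ∈ Metric.ball (0 : ℂ) 1 := by
      simpa [hu, abs_of_pos hr0] using hr1
    have hd := (hΨ.differentiableAt Metric.isOpen_ball hz).hasDerivAt
    have h1 : HasDerivAt (fun ζ => Ψ (uc θ₀ * ζ)) (deriv Ψ (uc θ₀ * r) * uc θ₀) (r : ℂ) := by
      have := hd.comp (r : ℂ) ((hasDerivAt_id (r : ℂ)).const_mul (uc θ₀))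
      simpa [Function.comp_def] using this
    have h2 : HasDerivAt H (deriv Ψ (uc θ₀ * r) * uc θ₀ - l * uc θ₀ * 1) (r : ℂ) :=
      (h1.sub_const _).sub (((hasDerivAt_id (r : ℂ)).sub_const 1).const_mul _)
    rw [h2.deriv, mul_comm (r : ℂ)]
    have := uc_ne_zero θ₀
    field_simp
    ring
  have := (key.const_mul (uc θ₀)⁻¹).add_const l
  rw [mul_zero, zero_add] at this
  exact this.congr' hder

instance isFiniteMeasure_bMeasure : IsFiniteMeasure bMeasure := by
  unfold bMeasure; infer_instance

lemma intervalIntegral_eq_bMeasure (f : ℝ → ℂ) :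
    ∫ θ in (0:ℝ)..(2 * Real.pi), f θ = ∫ θ, f θ ∂bMeasure :=
  intervalIntegral.integral_of_le Real.two_pi_pos.le

lemma uc_zpow (n : ℤ) (θ : ℝ) : uc θ ^ n = Complex.exp ((n * I) * θ) := by
  rw [uc, ← Complex.exp_int_mul]; ring_nf

lemma integral_uc_zpow (n : ℤ) :
    ∫ θ, uc θ ^ n ∂bMeasure = if n = 0 then 2 * (Real.pi : ℂ) else 0 := by
  rw [← intervalIntegral_eq_bMeasure]
  split_ifs with h
  · simp [h]
  · have hn : (n : ℂ) * I ≠ 0 := by simp [h]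
    simp_rw [uc_zpow]
    rw [integral_exp_mul_complex hn]
    have : Complex.exp (n * I * (2 * Real.pi : ℝ)) = 1 := by
      rw [← Complex.exp_int_mul_two_pi_mul_I n]; push_cast; ring_nf
    rw [this]; simp

lemma memLp_uc_zpow (n : ℤ) : MemLp (fun θ => uc θ ^ n) 2 bMeasure := by
  refine MemLp.of_bound (C := 1) ?_ (ae_of_all _ fun θ => by simp [norm_uc])
  simp_rw [uc_zpow]
  exact Continuous.aestronglyMeasurable (by fun_prop)

lemma inner_toLp_bMeasure {f g : ℝ → ℂ} (hf : MemLp f 2 bMeasure) (hg : MemLp g 2 bMeasure) :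
    inner ℂ (hf.toLp f) (hg.toLp g) = ∫ θ, g θ * (starRingEnd ℂ) (f θ) ∂bMeasure := by
  rw [L2.inner_def]
  refine integral_congr_ae ?_
  filter_upwards [hf.coeFn_toLp, hg.coeFn_toLp] with θ h1 h2
  rw [h1, h2]; rfl

lemma conj_uc_zpow (n : ℤ) (θ : ℝ) : (starRingEnd ℂ) (uc θ ^ n) = uc θ ^ (-n) := by
  rw [uc_zpow, uc_zpow, ← Complex.exp_conj]; simp

/-- The normalized trigonometric system in `L²` of the circle. -/
def expLp (n : ℤ) : Lp ℂ 2 bMeasure :=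
  ((√(2 * Real.pi))⁻¹ : ℂ) • (memLp_uc_zpow n).toLp _

lemma sqrt_two_pi_mul_self : ((√(2 * Real.pi) : ℝ) : ℂ) * (√(2 * Real.pi) : ℝ) = 2 * Real.pi := by
  rw [← Complex.ofReal_mul, Real.mul_self_sqrt Real.two_pi_pos.le]; push_cast; ring

lemma sqrt_two_pi_ne_zero : ((√(2 * Real.pi) : ℝ) : ℂ) ≠ 0 := by
  simpa using (Real.sqrt_ne_zero'.2 Real.two_pi_pos)

lemma orthonormal_expLp : Orthonormal ℂ expLp := by
  rw [orthonormal_iff_ite]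
  intro i j
  have hs := sqrt_two_pi_ne_zero
  have hp := sqrt_two_pi_mul_self
  rw [expLp, expLp, inner_smul_left, inner_smul_right, inner_toLp_bMeasure]
  simp_rw [conj_uc_zpow, ← zpow_add₀ (uc_ne_zero _)]
  rw [integral_uc_zpow, ← hp]
  by_cases h : i = j
  · simp [h]; field_simp
  · have : j + -i ≠ 0 := by lia
    simp [h, this]

/-- The Fourier coefficients of a function on the circle. -/
def fc (u : ℝ → ℂ) (n : ℤ) : ℂ :=
  (1 / (2 * (Real.pi : ℂ))) * ∫ θ, u θ * uc θ ^ (-n) ∂bMeasure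

lemma inner_expLp {u : ℝ → ℂ} (hu : MemLp u 2 bMeasure) (n : ℤ) :
    inner ℂ (expLp n) (hu.toLp u) = √(2 * Real.pi) * fc u n := by
  rw [expLp, inner_smul_left, inner_toLp_bMeasure, fc, ← sqrt_two_pi_mul_self]
  simp_rw [conj_uc_zpow]
  have := sqrt_two_pi_ne_zero
  simp
  field_simp

lemma norm_inner_expLp_sq {u : ℝ → ℂ} (hu : MemLp u 2 bMeasure) (n : ℤ) :
    ‖inner ℂ (expLp n) (hu.toLp u)‖ ^ 2 = 2 * Real.pi * ‖fc u n‖ ^ 2 := by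
  rw [inner_expLp, norm_mul, mul_pow, Complex.norm_real, Real.norm_eq_abs, sq_abs,
    Real.sq_sqrt Real.two_pi_pos.le]

lemma summable_norm_fc_sq {u : ℝ → ℂ} (hu : MemLp u 2 bMeasure) :
    Summable fun n : ℤ => ‖fc u n‖ ^ 2 := by
  have h := orthonormal_expLp.inner_products_summable (hu.toLp u)
  simp_rw [norm_inner_expLp_sq] at h
  exact (summable_mul_left_iff (by positivity)).1 h

/-- The Riesz–Fischer theorem for sequences supported on `ℕ`. -/
lemma exists_memLp_of_summable_sq {c : ℕ → ℂ} (hc : Summable fun n => ‖c n‖ ^ 2) :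
    ∃ u : ℝ → ℂ, MemLp u 2 bMeasure ∧ ∀ G : ℝ → ℂ, MemLp G 2 bMeasure →
      HasSum (fun n => c n * ∫ θ, G θ * uc θ ^ n ∂bMeasure) (∫ θ, G θ * u θ ∂bMeasure) := by
  have ho : Orthonormal ℂ fun n : ℕ => expLp n :=
    orthonormal_expLp.comp _ Nat.cast_injective
  have hs : Summable fun n : ℕ => (√(2 * Real.pi) * c n) • expLp n := by
    have := (ho.orthogonalFamily).summable_iff_norm_sq_summable
      (fun n => (√(2 * Real.pi) * c n : ℂ))
    simp only [LinearIsometry.toSpanSingleton_apply] at this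
    rw [this]
    simp_rw [norm_mul, mul_pow]
    exact hc.mul_left _
  obtain ⟨U, hU⟩ := hs
  refine ⟨U, Lp.memLp U, fun G hG => ?_⟩
  have hG' : MemLp (fun θ => (starRingEnd ℂ) (G θ)) 2 bMeasure := hG.star
  have h := hU.mapL (innerSL ℂ (hG'.toLp _))
  have e1 : (innerSL ℂ (hG'.toLp _)) U = ∫ θ, G θ * U θ ∂bMeasure := by
    have hU' : U = (Lp.memLp U).toLp _ := by simp
    rw [innerSL_apply_apply]
    nth_rw 1 [hU']
    rw [inner_toLp_bMeasure]
    simp [mul_comm]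
  rw [e1] at h
  have e2 : ∀ n : ℕ, innerSL ℂ (hG'.toLp _) ((√(2 * Real.pi) * c n) • expLp n) =
      c n * ∫ θ, G θ * uc θ ^ n ∂bMeasure := fun n => ?_
  · simp_rw [e2] at h
    exact h
  have hs0 := sqrt_two_pi_ne_zero
  rw [innerSL_apply_apply, inner_smul_right, expLp, inner_smul_right, inner_toLp_bMeasure]
  simp only [zpow_natCast, starRingEnd_self_apply, mul_comm (G _)]
  field_simp

lemma HasSum.congr_terms {f g : ℕ → ℂ} {s : ℂ} (h : HasSum f s) (e : ∀ n, f n = g n) :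
    HasSum g s := funext e ▸ h

/-- `f` is the sum on the disk of the power series with square summable coefficients `c`. -/
def HasCoeff (f : ℂ → ℂ) (c : ℕ → ℂ) : Prop :=
  (Summable fun n => ‖c n‖ ^ 2) ∧ ∀ z ∈ unitDisk, HasSum (fun n => c n * z ^ n) (f z)

lemma summable_norm_div_succ {c : ℕ → ℂ} (hc : Summable fun n => ‖c n‖ ^ 2) :
    Summable fun n : ℕ => ‖c n / (n + 1)‖ := by
  have h2 : Summable fun n : ℕ => 1 / ((n + 1 : ℕ) : ℝ) ^ 2 :=
    (summable_nat_add_iff 1).2 (Real.summable_one_div_nat_pow.2 one_lt_two)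
  refine Summable.of_nonneg_of_le (fun n => norm_nonneg _) (fun n => ?_) (hc.add h2)
  have h3 : ‖c n / (n + 1)‖ = ‖c n‖ * (1 / ((n + 1 : ℕ) : ℝ)) := by
    rw [norm_div, ← Nat.cast_add_one, Complex.norm_natCast]; ring
  rw [h3]
  have h4 : 1 / ((n + 1 : ℕ) : ℝ) ^ 2 = (1 / ((n + 1 : ℕ) : ℝ)) ^ 2 := by rw [div_pow, one_pow]
  rw [h4]
  nlinarith [sq_nonneg (‖c n‖ - 1 / ((n + 1 : ℕ) : ℝ)), sq_nonneg ‖c n‖,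
    sq_nonneg (1 / ((n + 1 : ℕ) : ℝ))]

/-- The primitive of the power series with coefficients `c`. -/
def primSeries (c : ℕ → ℂ) (z : ℂ) : ℂ := ∑' n : ℕ, c n / (n + 1) * z ^ (n + 1)

lemma norm_primSeries_term_le (c : ℕ → ℂ) (n : ℕ) {z : ℂ} (hz : ‖z‖ ≤ 1) :
    ‖c n / (n + 1) * z ^ (n + 1)‖ ≤ ‖c n / (n + 1)‖ := by
  rw [norm_mul, norm_pow]
  exact mul_le_of_le_one_right (norm_nonneg _) (pow_le_one₀ (norm_nonneg _) hz)

lemma hasSum_primSeries {c : ℕ → ℂ} (hc : Summable fun n => ‖c n‖ ^ 2) {z : ℂ} (hz : ‖z‖ ≤ 1) :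
    HasSum (fun n : ℕ => c n / (n + 1) * z ^ (n + 1)) (primSeries c z) :=
  (Summable.of_norm_bounded (summable_norm_div_succ hc)
    fun n => norm_primSeries_term_le c n hz).hasSum

lemma diffContOnCl_primSeries {c : ℕ → ℂ} (hc : Summable fun n => ‖c n‖ ^ 2) :
    DiffContOnCl ℂ (primSeries c) (Metric.ball 0 1) := by
  constructor
  · refine differentiableOn_tsum_of_summable_norm (summable_norm_div_succ hc)
      (fun n => by fun_prop) Metric.isOpen_ball fun n z hz => ?_
    exact norm_primSeries_term_le c n (mem_ball_zero_iff.1 hz).le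
  · rw [closure_ball _ one_ne_zero]
    refine continuousOn_tsum (fun n => by fun_prop) (summable_norm_div_succ hc) fun n z hz => ?_
    exact norm_primSeries_term_le c n (by simpa using hz)

lemma HasCoeff.deriv_primSeries {f : ℂ → ℂ} {c : ℕ → ℂ} (h : HasCoeff f c) {z : ℂ}
    (hz : z ∈ unitDisk) : deriv (primSeries c) z = f z := by
  have h1 := hasSum_deriv_of_summable_norm (summable_norm_div_succ h.1)
    (F := fun n z => c n / (n + 1) * z ^ (n + 1))
    (fun n => by fun_prop) Metric.isOpen_ball (fun n z hz =>
      norm_primSeries_term_le c n (mem_ball_zero_iff.1 hz).le) hz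
  refine (h1.congr_terms fun n => ?_).unique (h.2 z hz)
  have h0 : (n : ℂ) + 1 ≠ 0 := by exact_mod_cast n.succ_ne_zero
  simp
  field_simp

lemma integral_I_mul_uc_pow (n : ℕ) (θ : ℝ) :
    ∫ t in (0:ℝ)..θ, I * uc t * uc t ^ n = (uc θ ^ (n + 1) - 1) / (n + 1) := by
  have h0 : (n : ℂ) + 1 ≠ 0 := by exact_mod_cast n.succ_ne_zero
  have h := intervalIntegral.integral_eq_sub_of_hasDerivAt (a := 0) (b := θ)
    (f := fun t => uc t ^ (n + 1) / ((n : ℂ) + 1)) (f' := fun t => I * uc t * uc t ^ n)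
    (fun t _ => by
      have h1 := ((hasDerivAt_uc t).fun_pow (n + 1)).div_const ((n : ℂ) + 1)
      have e : (((n + 1 : ℕ) : ℂ) * uc t ^ (n + 1 - 1) * (uc t * I)) / ((n : ℂ) + 1) =
          I * uc t * uc t ^ n := by
        push_cast; field_simp
      rw [e] at h1
      exact h1)
    (by have := continuous_uc; exact Continuous.intervalIntegrable (by fun_prop) _ _)
  rw [h]
  simp [uc]
  ring

lemma integral_indicator_bMeasure {θ : ℝ} (hθ : θ ∈ Set.Icc 0 (2 * Real.pi)) (X : ℝ → ℂ) :
    ∫ t, (Set.Ioc 0 θ).indicator (fun t => I * uc t) t * X t ∂bMeasure =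
      ∫ t in (0:ℝ)..θ, I * uc t * X t := by
  rw [intervalIntegral.integral_of_le hθ.1, bMeasure]
  have : ∀ t, (Set.Ioc 0 θ).indicator (fun t => I * uc t) t * X t =
      (Set.Ioc 0 θ).indicator (fun t => I * uc t * X t) t := fun t => by
    by_cases h : t ∈ Set.Ioc 0 θ <;> simp [h]
  simp_rw [this]
  rw [integral_indicator measurableSet_Ioc, Measure.restrict_restrict measurableSet_Ioc,
    Set.inter_eq_left.2 (Set.Ioc_subset_Ioc_right hθ.2)]

lemma primSeries_uc_sub {c : ℕ → ℂ} (hc : Summable fun n => ‖c n‖ ^ 2) {u : ℝ → ℂ}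
    (hu : ∀ G : ℝ → ℂ, MemLp G 2 bMeasure →
      HasSum (fun n => c n * ∫ θ, G θ * uc θ ^ n ∂bMeasure) (∫ θ, G θ * u θ ∂bMeasure))
    {θ : ℝ} (hθ : θ ∈ Set.Icc 0 (2 * Real.pi)) :
    primSeries c (uc θ) = primSeries c 1 + ∫ t in (0:ℝ)..θ, I * uc t * u t := by
  have hG : MemLp ((Set.Ioc 0 θ).indicator fun t => I * uc t) 2 bMeasure := by
    refine MemLp.indicator measurableSet_Ioc ?_
    exact MemLp.of_bound (C := 1)
      (Continuous.aestronglyMeasurable (by have := continuous_uc; fun_prop))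
      (ae_of_all _ fun θ => by simp [norm_uc])
  have h1 := hu _ hG
  rw [integral_indicator_bMeasure hθ] at h1
  have h2 := (hasSum_primSeries hc (norm_uc θ).le).sub
    (hasSum_primSeries hc (z := 1) (by simp))
  rw [← sub_eq_iff_eq_add']
  refine h2.unique (h1.congr_terms fun n => ?_)
  rw [integral_indicator_bMeasure hθ, integral_I_mul_uc_pow]
  ring

/-- Fatou's theorem for power series with square summable coefficients. -/
lemma HasCoeff.exists_bdry {f : ℂ → ℂ} {c : ℕ → ℂ} (h : HasCoeff f c) :
    ∃ u : ℝ → ℂ, MemLp u 2 bMeasure ∧ bdry f =ᵐ[bMeasure] u ∧ ∀ G : ℝ → ℂ, MemLp G 2 bMeasure →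
      HasSum (fun n => c n * ∫ θ, G θ * uc θ ^ n ∂bMeasure) (∫ θ, G θ * u θ ∂bMeasure) := by
  obtain ⟨u, hu, hG⟩ := exists_memLp_of_summable_sq h.1
  refine ⟨u, hu, ?_, hG⟩
  have hi : IntervalIntegrable (fun t => I * uc t * u t) volume 0 (2 * Real.pi) := by
    rw [intervalIntegrable_iff_integrableOn_Ioc_of_le Real.two_pi_pos.le]
    have h1 : Integrable u bMeasure := hu.integrable one_le_two
    exact h1.bdd_mul (c := 1)
      (Continuous.aestronglyMeasurable (by have := continuous_uc; fun_prop))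
      (ae_of_all _ fun θ => by simp [norm_uc])
  have hd := hi.ae_hasDerivAt_integral
  have hne : ∀ᵐ θ : ℝ, θ ≠ 2 * Real.pi := by simp [ae_iff]
  rw [bMeasure, Filter.EventuallyEq, ae_restrict_iff' measurableSet_Ioc]
  filter_upwards [hd, hne] with θ h1 h2 h3
  have hint : θ ∈ Set.Ioo 0 (2 * Real.pi) := ⟨h3.1, lt_of_le_of_ne h3.2 h2⟩
  have h4 := h1 (by rw [Set.uIcc_of_le Real.two_pi_pos.le]; exact ⟨h3.1.le, h3.2⟩) 0 (by simp)
  have h5 : HasDerivAt (fun θ => primSeries c (uc θ)) (I * uc θ * u θ) θ := by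
    refine (h4.const_add (primSeries c 1)).congr_of_eventuallyEq ?_
    filter_upwards [isOpen_Ioo.mem_nhds hint] with x hx
    exact primSeries_uc_sub h.1 hG ⟨hx.1.le, hx.2.le⟩
  have h6 := tendsto_deriv_radial (diffContOnCl_primSeries h.1) h5
  refine Tendsto.limUnder_eq (h6.congr' ?_)
  filter_upwards [self_mem_nhdsWithin,
    nhdsWithin_le_nhds (eventually_gt_nhds (zero_lt_one (α := ℝ)))] with r hr1 hr0
  refine h.deriv_primSeries ?_
  simpa [unitDisk, norm_uc, abs_of_pos (hr0 : 0 < r)] using hr1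

lemma HasCoeff.memLp_bdry {f : ℂ → ℂ} {c : ℕ → ℂ} (h : HasCoeff f c) :
    MemLp (bdry f) 2 bMeasure := by
  obtain ⟨u, hu, he, -⟩ := h.exists_bdry
  exact (memLp_congr_ae he).2 hu

lemma HasCoeff.hasSum_integral {f : ℂ → ℂ} {c : ℕ → ℂ} (h : HasCoeff f c) {G : ℝ → ℂ}
    (hG : MemLp G 2 bMeasure) :
    HasSum (fun n => c n * ∫ θ, G θ * uc θ ^ n ∂bMeasure) (∫ θ, G θ * bdry f θ ∂bMeasure) := by
  obtain ⟨u, hu, he, hs⟩ := h.exists_bdry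
  have : ∫ θ, G θ * bdry f θ ∂bMeasure = ∫ θ, G θ * u θ ∂bMeasure :=
    integral_congr_ae (he.mono fun θ h => by simp only [h])
  rw [this]
  exact hs G hG

lemma HasCoeff.congr {f g : ℂ → ℂ} {c : ℕ → ℂ} (h : HasCoeff f c)
    (e : ∀ z ∈ unitDisk, g z = f z) : HasCoeff g c :=
  ⟨h.1, fun z hz => e z hz ▸ h.2 z hz⟩

lemma fc_bdry {f : ℂ → ℂ} {c : ℕ → ℂ} (h : HasCoeff f c) (m : ℕ) : fc (bdry f) m = c m := by
  have h1 := h.hasSum_integral (memLp_uc_zpow (-m))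
  have h2 := hasSum_single (f := fun n => c n * ∫ θ, uc θ ^ (-m : ℤ) * uc θ ^ n ∂bMeasure) m
    fun n hn => by
      simp_rw [← zpow_natCast, ← zpow_add₀ (uc_ne_zero _)]
      rw [integral_uc_zpow, if_neg (by lia), mul_zero]
  have h3 := h1.unique h2
  simp_rw [← zpow_natCast, ← zpow_add₀ (uc_ne_zero _)] at h3
  rw [integral_uc_zpow, if_pos (by lia)] at h3
  rw [fc]
  simp_rw [mul_comm (bdry f _)]
  rw [h3]
  have := Real.pi_ne_zero
  field_simp

lemma HasCoeff.unique {f : ℂ → ℂ} {c d : ℕ → ℂ} (h : HasCoeff f c) (h' : HasCoeff f d) : c = d :=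
  funext fun n => (fc_bdry h n).symm.trans (fc_bdry h' n)

/-- Parseval's identity. -/
lemma hasSum_bInner {f g : ℂ → ℂ} {c d : ℕ → ℂ} (hf : HasCoeff f c) (hg : HasCoeff g d) :
    HasSum (fun n => c n * (starRingEnd ℂ) (d n)) (bInner f g) := by
  have hG : MemLp (fun θ => (starRingEnd ℂ) (bdry g θ)) 2 bMeasure := hg.memLp_bdry.star
  have h := (hf.hasSum_integral hG).mul_left (1 / (2 * (Real.pi : ℂ)))
  have e : bInner f g = 1 / (2 * (Real.pi : ℂ)) *
      ∫ θ, (starRingEnd ℂ) (bdry g θ) * bdry f θ ∂bMeasure := by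
    rw [bInner, intervalIntegral_eq_bMeasure]
    simp_rw [mul_comm]
  rw [e]
  refine h.congr_terms fun n => ?_
  rw [← fc_bdry hg n, fc, map_mul, ← integral_conj]
  simp only [map_mul, conj_uc_zpow, neg_neg, zpow_natCast, map_div₀, map_one, map_ofNat,
    Complex.conj_ofReal]
  ring

lemma HasCoeff.hasSum_norm_sq {f : ℂ → ℂ} {c : ℕ → ℂ} (h : HasCoeff f c) :
    HasSum (fun n => ‖c n‖ ^ 2) (bInner f f).re := by
  have h1 := Complex.hasSum_re (hasSum_bInner h h)
  simpa only [Complex.mul_conj', ← Complex.ofReal_pow, Complex.ofReal_re] using h1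

lemma bdry_eq_of_continuousAt {f : ℂ → ℂ} {θ : ℝ} (h : ContinuousAt f (uc θ)) :
    bdry f θ = f (uc θ) := by
  refine Tendsto.limUnder_eq ?_
  have h1 : Tendsto (fun r : ℝ => (r : ℂ) * uc θ) (nhdsWithin 1 (Set.Iio 1)) (nhds (uc θ)) := by
    have : Tendsto (fun r : ℝ => (r : ℂ) * uc θ) (nhds 1) (nhds (((1 : ℝ) : ℂ) * uc θ)) :=
      Continuous.tendsto (by fun_prop) 1
    rw [Complex.ofReal_one, one_mul] at this
    exact this.mono_left nhdsWithin_le_nhds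
  exact h.tendsto.comp h1

lemma summable_norm_sq_of_summable {c : ℕ → ℂ} (h : Summable c) : Summable fun n => ‖c n‖ ^ 2 := by
  have h1 : Summable fun n => ‖c n‖ := h.norm
  refine Summable.of_norm_bounded_eventually_nat h1 ?_
  filter_upwards [h1.tendsto_atTop_zero.eventually_le_const zero_lt_one] with n hn
  rw [norm_pow, norm_norm, sq]
  exact mul_le_of_le_one_left (norm_nonneg _) hn

lemma real_mul_uc_mem {r : ℝ} (hr : r ∈ Set.Ico (0 : ℝ) 1) (θ : ℝ) :
    (r : ℂ) * uc θ ∈ unitDisk := by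
  simpa [unitDisk, norm_uc, abs_of_nonneg hr.1] using hr.2

/-- Parseval's identity on the circle of radius `r < 1`. -/
lemma hasSum_norm_sq_dilate {f : ℂ → ℂ} {c : ℕ → ℂ} (hd : DifferentiableOn ℂ f unitDisk)
    (hc : ∀ z ∈ unitDisk, HasSum (fun n => c n * z ^ n) (f z)) {r : ℝ}
    (hr : r ∈ Set.Ico (0 : ℝ) 1) :
    HasSum (fun n => ‖c n‖ ^ 2 * (r ^ n) ^ 2)
      ((2 * Real.pi)⁻¹ * ∫ θ in (0:ℝ)..(2 * Real.pi), ‖f ((r : ℂ) * uc θ)‖ ^ 2) := by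
  have hrd : (r : ℂ) ∈ unitDisk := by simpa [unitDisk, abs_of_nonneg hr.1] using hr.2
  have h : HasCoeff (fun z => f (r * z)) fun n => c n * (r : ℂ) ^ n := by
    refine ⟨summable_norm_sq_of_summable (hc r hrd).summable, fun z hz => ?_⟩
    have : (r : ℂ) * z ∈ unitDisk := by
      simp only [unitDisk, mem_ball_zero_iff] at hz hrd ⊢
      rw [norm_mul]
      exact mul_lt_one_of_nonneg_of_lt_one_left (norm_nonneg _) hrd hz.le
    refine (hc _ this).congr_terms fun n => ?_
    ring
  have h1 := h.hasSum_norm_sq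
  have hb : ∀ θ, bdry (fun z => f (r * z)) θ = f (r * uc θ) := fun θ => by
    refine bdry_eq_of_continuousAt (f := fun z => f (r * z)) ?_
    have h2 : ContinuousAt f (r * uc θ) := ((hd _ (real_mul_uc_mem hr θ)).differentiableAt
      (Metric.isOpen_ball.mem_nhds (real_mul_uc_mem hr θ))).continuousAt
    exact ContinuousAt.comp (f := fun z : ℂ => (r : ℂ) * z) h2 (by fun_prop)
  have e : (bInner (fun z => f (r * z)) (fun z => f (r * z))).re =
      (2 * Real.pi)⁻¹ * ∫ θ in (0:ℝ)..(2 * Real.pi), ‖f ((r : ℂ) * uc θ)‖ ^ 2 := by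
    simp_rw [bInner, hb, Complex.mul_conj', ← Complex.ofReal_pow]
    rw [intervalIntegral.integral_ofReal, one_div, ← Complex.ofReal_ofNat, ← Complex.ofReal_mul,
      ← Complex.ofReal_inv, ← Complex.ofReal_mul, Complex.ofReal_re]
  rw [e] at h1
  simpa [mul_pow, abs_of_nonneg hr.1] using h1

lemma MemH2.exists_hasCoeff {f : ℂ → ℂ} (h : MemH2 f) : ∃ c, HasCoeff f c := by
  obtain ⟨hd, C, hC⟩ := h
  set c : ℕ → ℂ := fun n => (n.factorial : ℂ)⁻¹ * iteratedDeriv n f 0 with hcdef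
  have hc : ∀ z ∈ unitDisk, HasSum (fun n => c n * z ^ n) (f z) := fun z hz => by
    refine (Complex.hasSum_taylorSeries_on_ball hd hz).congr_terms fun n => ?_
    simp [hcdef]; ring
  refine ⟨c, summable_of_sum_le (c := (2 * Real.pi)⁻¹ * C) (fun n => by positivity) fun s => ?_, hc⟩
  have ht : Tendsto (fun r : ℝ => ∑ n ∈ s, ‖c n‖ ^ 2 * (r ^ n) ^ 2) (nhdsWithin 1 (Set.Iio 1))
      (nhds (∑ n ∈ s, ‖c n‖ ^ 2 * ((1:ℝ) ^ n) ^ 2)) :=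
    (Continuous.tendsto (by fun_prop) 1).mono_left nhdsWithin_le_nhds
  simp only [one_pow, mul_one] at ht
  refine le_of_tendsto ht ?_
  filter_upwards [self_mem_nhdsWithin,
    nhdsWithin_le_nhds (eventually_gt_nhds (zero_lt_one (α := ℝ)))] with r hr1 hr0
  have hr : r ∈ Set.Ico (0 : ℝ) 1 := ⟨le_of_lt hr0, hr1⟩
  refine (sum_le_hasSum s (fun n _ => by positivity) (hasSum_norm_sq_dilate hd hc hr)).trans ?_
  gcongr
  exact hC r hr

lemma HasCoeff.memH2 {f : ℂ → ℂ} {c : ℕ → ℂ} (h : HasCoeff f c) : MemH2 f := by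
  have hd : DifferentiableOn ℂ f unitDisk :=
    ((diffContOnCl_primSeries h.1).differentiableOn.deriv Metric.isOpen_ball).congr
      fun z hz => (h.deriv_primSeries hz).symm
  refine ⟨hd, 2 * Real.pi * ∑' n, ‖c n‖ ^ 2, fun r hr => ?_⟩
  have h1 := hasSum_norm_sq_dilate hd h.2 hr
  have h2 := hasSum_le (fun n => mul_le_of_le_one_right (sq_nonneg ‖c n‖)
    (pow_le_one₀ (by have := hr.1; positivity) (pow_le_one₀ hr.1 hr.2.le))) h1 h.1.hasSum
  rwa [inv_mul_le_iff₀ Real.two_pi_pos] at h2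

lemma hasCoeff_tsum {c : ℕ → ℂ} (hc : Summable fun n => ‖c n‖ ^ 2) :
    HasCoeff (fun z => ∑' n, c n * z ^ n) c := by
  refine ⟨hc, fun z hz => Summable.hasSum ?_⟩
  have hz1 : ‖z‖ < 1 := by simpa [unitDisk] using hz
  have hg : Summable fun n => (‖z‖ ^ 2) ^ n :=
    summable_geometric_of_lt_one (by positivity) (pow_lt_one₀ (norm_nonneg _) hz1 two_ne_zero)
  refine Summable.of_norm_bounded (hc.add hg) fun n => ?_
  rw [norm_mul, norm_pow, ← pow_mul, mul_comm 2 n, pow_mul]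
  nlinarith [sq_nonneg (‖c n‖ - ‖z‖ ^ n), sq_nonneg ‖c n‖, sq_nonneg (‖z‖ ^ n)]

lemma hasCoeff_szProj {u : ℝ → ℂ} (hu : MemLp u 2 bMeasure) :
    HasCoeff (szProj u) fun n => fc u n := by
  refine ⟨(summable_norm_fc_sq hu).comp_injective Nat.cast_injective, fun z hz => ?_⟩
  have hz1 : ‖z‖ < 1 := by simpa [unitDisk] using hz
  have hi : Integrable u bMeasure := hu.integrable one_le_two
  have hint : ∀ n : ℕ, Integrable (fun θ => z ^ n * (u θ * uc θ ^ (-n : ℤ))) bMeasure := fun n =>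
    (hi.mul_bdd (c := 1) (memLp_uc_zpow _).aestronglyMeasurable
      (ae_of_all _ fun θ => by simp [norm_uc])).const_mul _
  have hn : ∀ n : ℕ, ∫ θ, ‖z ^ n * (u θ * uc θ ^ (-n : ℤ))‖ ∂bMeasure =
      ‖z‖ ^ n * ∫ θ, ‖u θ‖ ∂bMeasure := fun n => by
    rw [← integral_const_mul]
    simp [norm_uc]
  have h1 := hasSum_integral_of_summable_integral_norm hint (by
    simp_rw [hn]
    exact (summable_geometric_of_lt_one (norm_nonneg _) hz1).mul_right _)
  have h2 := h1.mul_left (1 / (2 * (Real.pi : ℂ)))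
  have e : szProj u z = 1 / (2 * (Real.pi : ℂ)) *
      ∫ θ, ∑' n : ℕ, z ^ n * (u θ * uc θ ^ (-n : ℤ)) ∂bMeasure := by
    rw [szProj, intervalIntegral_eq_bMeasure]
    congr 2
    funext θ
    have h3 := (hasSum_geometric_of_norm_lt_one (ξ := z * (uc θ)⁻¹) (by
      simpa [norm_uc] using hz1)).mul_left (u θ)
    rw [← h3.tsum_eq]
    congr 1; funext n
    simp [mul_pow]; ring
  rw [e]
  refine h2.congr_terms fun n => ?_
  simp only [fc, integral_const_mul]
  ring

lemma summable_norm_sq_linear {c d : ℕ → ℂ} (hc : Summable fun n => ‖c n‖ ^ 2)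
    (hd : Summable fun n => ‖d n‖ ^ 2) (α β : ℂ) :
    Summable fun n => ‖α * c n + β * d n‖ ^ 2 := by
  refine Summable.of_nonneg_of_le (fun n => by positivity) (fun n => ?_)
    ((hc.mul_left (2 * ‖α‖ ^ 2)).add (hd.mul_left (2 * ‖β‖ ^ 2)))
  have h := norm_add_le (α * c n) (β * d n)
  rw [norm_mul, norm_mul] at h
  have h2 := pow_le_pow_left₀ (norm_nonneg _) h 2
  nlinarith [sq_nonneg (‖α‖ * ‖c n‖ - ‖β‖ * ‖d n‖)]

lemma HasCoeff.linear {f g : ℂ → ℂ} {c d : ℕ → ℂ} (hf : HasCoeff f c) (hg : HasCoeff g d)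
    (α β : ℂ) : HasCoeff (fun z => α * f z + β * g z) fun n => α * c n + β * d n := by
  refine ⟨summable_norm_sq_linear hf.1 hg.1 α β, fun z hz => ?_⟩
  refine (((hf.2 z hz).mul_left α).add ((hg.2 z hz).mul_left β)).congr_terms fun n => ?_
  ring

/-- The coefficients of `z * f z`. -/
def shiftCoeff (c : ℕ → ℂ) : ℕ → ℂ
  | 0 => 0
  | n + 1 => c n

lemma HasCoeff.shift {f : ℂ → ℂ} {c : ℕ → ℂ} (h : HasCoeff f c) :
    HasCoeff (fun z => z * f z) (shiftCoeff c) := by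
  refine ⟨(summable_nat_add_iff 1).1 h.1, fun z hz => ?_⟩
  refine (hasSum_nat_add_iff' 1).1 ?_
  simp only [Finset.range_one, Finset.sum_singleton, shiftCoeff, zero_mul, sub_zero]
  refine ((h.2 z hz).mul_left z).congr_terms fun n => ?_
  ring

/-- The coefficients of the constant function `1`. -/
def oneCoeff (n : ℕ) : ℂ := if n = 0 then 1 else 0

lemma hasCoeff_one : HasCoeff (fun _ => 1) oneCoeff := by
  have h0 : ∀ n ≠ 0, oneCoeff n = 0 := fun n hn => if_neg hn
  refine ⟨(hasSum_single 0 fun n hn => by simp [h0 n hn]).summable, fun z _ => ?_⟩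
  have h := hasSum_single (f := fun n => oneCoeff n * z ^ n) 0 fun n hn => by simp [h0 n hn]
  simpa [oneCoeff] using h

lemma HasCoeff.eqOn {f g : ℂ → ℂ} {c : ℕ → ℂ} (hf : HasCoeff f c) (hg : HasCoeff g c) :
    ∀ z ∈ unitDisk, f z = g z := fun z hz => (hf.2 z hz).unique (hg.2 z hz)

lemma hasCoeff_toeplitz {φ : ℝ → ℂ} {α β : ℂ} {i j : ℕ}
    (hφ : ∀ θ, φ θ = α * uc θ ^ (-i : ℤ) + β * uc θ ^ (-j : ℤ)) {f : ℂ → ℂ} {c : ℕ → ℂ}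
    (h : HasCoeff f c) : HasCoeff (toeplitz φ f) fun n => α * c (n + i) + β * c (n + j) := by
  have hf := h.memLp_bdry
  have hm : ∀ k : ℤ, MemLp (fun θ => bdry f θ * uc θ ^ k) 2 bMeasure := fun k =>
    hf.mono (hf.aestronglyMeasurable.mul (memLp_uc_zpow k).aestronglyMeasurable)
      (ae_of_all _ fun θ => by simp [norm_uc])
  have he : (fun θ => φ θ * bdry f θ) =
      fun θ => α * (bdry f θ * uc θ ^ (-i : ℤ)) + β * (bdry f θ * uc θ ^ (-j : ℤ)) := by
    funext θ
    rw [hφ]; ring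
  have hφf : MemLp (fun θ => φ θ * bdry f θ) 2 bMeasure := by
    rw [he]
    exact ((hm _).const_mul α).add ((hm _).const_mul β)
  have h1 := hasCoeff_szProj hφf
  have hfc : ∀ n : ℕ, fc (fun θ => φ θ * bdry f θ) n = α * c (n + i) + β * c (n + j) := fun n => by
    have hint : ∀ k : ℤ, Integrable (fun θ => bdry f θ * uc θ ^ k) bMeasure := fun k =>
      (hm k).integrable one_le_two
    rw [← fc_bdry h, ← fc_bdry h, fc, fc, fc]
    have he' : ∀ θ, φ θ * bdry f θ * uc θ ^ (-n : ℤ) =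
        α * (bdry f θ * uc θ ^ (-((n + i : ℕ) : ℤ))) +
          β * (bdry f θ * uc θ ^ (-((n + j : ℕ) : ℤ))) := fun θ => by
      have e1 : ∀ k : ℕ, uc θ ^ (-((n + k : ℕ) : ℤ)) = uc θ ^ (-n : ℤ) * uc θ ^ (-k : ℤ) :=
        fun k => by
          rw [← zpow_add₀ (uc_ne_zero _)]; push_cast; ring_nf
      rw [hφ, e1, e1]; ring
    simp_rw [he']
    rw [integral_add ((hint _).const_mul α) ((hint _).const_mul β), integral_const_mul,
      integral_const_mul]
    ring
  have e : (fun n : ℕ => fc (fun θ => φ θ * bdry f θ) n) =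
      fun n => α * c (n + i) + β * c (n + j) := funext hfc
  rw [e] at h1
  exact h1

lemma toeplitz_eq_iff {a b₀ : ℂ → ℂ} (ha : ∀ z, a z = (1 + z) / 2)
    (hb₀ : ∀ z, b₀ z = z * (1 - z) / 2) {h h' : ℂ → ℂ} {c d : ℕ → ℂ} (hc : HasCoeff h c)
    (hd : HasCoeff h' d) :
    (∀ z ∈ unitDisk, toeplitz (conjBdry b₀) h z = toeplitz (conjBdry a) h' z) ↔
      ∀ n, c (n + 1) - c (n + 2) = d n + d (n + 1) := by
  have hconj : ∀ θ, (starRingEnd ℂ) (uc θ) = (uc θ)⁻¹ := fun θ => by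
    simpa using conj_uc_zpow 1 θ
  have h1 : HasCoeff (toeplitz (conjBdry b₀) h) _ :=
    hasCoeff_toeplitz (α := 1 / 2) (β := -1 / 2) (i := 1) (j := 2) (fun θ => by
      have hcont : ContinuousAt b₀ (uc θ) := by
        rw [funext hb₀]; exact Continuous.continuousAt (by fun_prop)
      rw [conjBdry, bdry_eq_of_continuousAt hcont, hb₀]
      have := uc_ne_zero θ
      simp only [map_div₀, map_mul, map_sub, map_one, map_ofNat, hconj, zpow_neg, zpow_natCast]
      field_simp
      ring) hc
  have h2 : HasCoeff (toeplitz (conjBdry a) h') _ :=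
    hasCoeff_toeplitz (α := 1 / 2) (β := 1 / 2) (i := 0) (j := 1) (fun θ => by
      have hcont : ContinuousAt a (uc θ) := by
        rw [funext ha]; exact Continuous.continuousAt (by fun_prop)
      rw [conjBdry, bdry_eq_of_continuousAt hcont, ha]
      have := uc_ne_zero θ
      simp only [map_div₀, map_add, map_one, map_ofNat, hconj, zpow_neg, zpow_natCast]
      field_simp) hd
  constructor
  · intro he n
    have := congrFun (h1.unique (h2.congr he)) n
    simp only [add_zero] at this
    linear_combination 2 * this
  · intro he
    refine HasCoeff.eqOn h1 ?_
    have e : (fun n => (1 / 2 : ℂ) * c (n + 1) + -1 / 2 * c (n + 2)) =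
        fun n => 1 / 2 * d (n + 0) + 1 / 2 * d (n + 1) := by
      funext n
      rw [add_zero]
      linear_combination (1 / 2) * he n
    rw [e]
    exact h2

/-- `h` has coefficients `c` and `h⁺` has coefficients `d`. -/
def HbCoeff (h : ℂ → ℂ) (c d : ℕ → ℂ) : Prop :=
  HasCoeff h c ∧ (Summable fun n => ‖d n‖ ^ 2) ∧ ∀ n, c (n + 1) - c (n + 2) = d n + d (n + 1)

lemma eq_zero_of_alternating {e : ℕ → ℂ} (he : Summable fun n => ‖e n‖ ^ 2)
    (h : ∀ n, e n + e (n + 1) = 0) (n : ℕ) : e n = 0 := by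
  have h1 : ∀ n, ‖e n‖ ^ 2 = ‖e 0‖ ^ 2 := fun n => by
    induction n with
    | zero => rfl
    | succ k ih => rw [← ih, eq_neg_of_add_eq_zero_right (h k), norm_neg]
  have h2 := he.tendsto_atTop_zero
  simp_rw [h1] at h2
  have h3 := tendsto_nhds_unique tendsto_const_nhds h2
  have h4 := h1 n
  rw [h3] at h4
  simpa using h4

lemma memHb_iff {a b₀ : ℂ → ℂ} (ha : ∀ z, a z = (1 + z) / 2)
    (hb₀ : ∀ z, b₀ z = z * (1 - z) / 2) {h : ℂ → ℂ} :
    MemHb b₀ a h ↔ ∃ c d, HbCoeff h c d := by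
  constructor
  · rintro ⟨hh, h', hh', he⟩
    obtain ⟨c, hc⟩ := hh.exists_hasCoeff
    obtain ⟨d, hd⟩ := hh'.exists_hasCoeff
    exact ⟨c, d, hc, hd.1, (toeplitz_eq_iff ha hb₀ hc hd).1 he⟩
  · rintro ⟨c, d, hc, hd, he⟩
    exact ⟨hc.memH2, _, (hasCoeff_tsum hd).memH2,
      (toeplitz_eq_iff ha hb₀ hc (hasCoeff_tsum hd)).2 he⟩

lemma HbCoeff.hasCoeff_plusFun {a b₀ : ℂ → ℂ} (ha : ∀ z, a z = (1 + z) / 2)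
    (hb₀ : ∀ z, b₀ z = z * (1 - z) / 2) {h : ℂ → ℂ} {c d : ℕ → ℂ} (hh : HbCoeff h c d) :
    HasCoeff (plusFun b₀ a h) d := by
  obtain ⟨hc, hd, he⟩ := hh
  have hspec := Classical.epsilon_spec (p := fun h' : ℂ → ℂ => MemH2 h' ∧
    ∀ z ∈ unitDisk, toeplitz (conjBdry b₀) h z = toeplitz (conjBdry a) h' z)
    ⟨_, (hasCoeff_tsum hd).memH2, (toeplitz_eq_iff ha hb₀ hc (hasCoeff_tsum hd)).2 he⟩
  change MemH2 (plusFun b₀ a h) ∧ ∀ z ∈ unitDisk, toeplitz (conjBdry b₀) h z =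
    toeplitz (conjBdry a) (plusFun b₀ a h) z at hspec
  obtain ⟨d', hd'⟩ := hspec.1.exists_hasCoeff
  have he' := (toeplitz_eq_iff ha hb₀ hc hd').1 hspec.2
  have hz := eq_zero_of_alternating (summable_norm_sq_linear hd'.1 hd 1 (-1)) fun n => by
    linear_combination he n - he' n
  have : d' = d := funext fun n => by linear_combination hz n
  rwa [this] at hd'

lemma HbCoeff.congr {h h₂ : ℂ → ℂ} {c d : ℕ → ℂ} (hh : HbCoeff h c d)
    (e : ∀ z ∈ unitDisk, h₂ z = h z) : HbCoeff h₂ c d :=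
  ⟨hh.1.congr e, hh.2⟩

lemma HbCoeff.linear {h h₂ : ℂ → ℂ} {c d c₂ d₂ : ℕ → ℂ} (hh : HbCoeff h c d)
    (hh₂ : HbCoeff h₂ c₂ d₂) (α β : ℂ) :
    HbCoeff (fun z => α * h z + β * h₂ z) (fun n => α * c n + β * c₂ n)
      fun n => α * d n + β * d₂ n :=
  ⟨hh.1.linear hh₂.1 α β, summable_norm_sq_linear hh.2.1 hh₂.2.1 α β, fun n => by
    linear_combination α * hh.2.2 n + β * hh₂.2.2 n⟩

/-- The coefficients of `(1 + z) / 2 * f z`. -/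
def mulACoeff (q : ℕ → ℂ) (n : ℕ) : ℂ := 1 / 2 * q n + 1 / 2 * shiftCoeff q n

lemma mem_rangeMa_iff {a : ℂ → ℂ} (ha : ∀ z, a z = (1 + z) / 2) {g : ℂ → ℂ} :
    g ∈ rangeMa a ↔ ∃ q : ℕ → ℂ, (Summable fun n => ‖q n‖ ^ 2) ∧ HasCoeff g (mulACoeff q) := by
  have key : ∀ {f q}, HasCoeff f q → HasCoeff (fun z => a z * f z) (mulACoeff q) := fun {f q} h =>
    (h.linear h.shift (1 / 2) (1 / 2)).congr fun z _ => by rw [ha]; ring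
  constructor
  · rintro ⟨f, hf, he⟩
    obtain ⟨q, hq⟩ := hf.exists_hasCoeff
    exact ⟨q, hq.1, (key hq).congr he⟩
  · rintro ⟨q, hq, hg⟩
    exact ⟨_, (hasCoeff_tsum hq).memH2, hg.eqOn (key (hasCoeff_tsum hq))⟩

lemma hbCoeff_mulA {g : ℂ → ℂ} {q : ℕ → ℂ} (hq : Summable fun n => ‖q n‖ ^ 2)
    (hg : HasCoeff g (mulACoeff q)) :
    HbCoeff g (mulACoeff q) fun n => 1 / 2 * q n + -1 / 2 * q (n + 1) :=
  ⟨hg, summable_norm_sq_linear hq ((summable_nat_add_iff 1).2 hq) _ _, fun n => by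
    simp only [mulACoeff, shiftCoeff]; ring⟩

/-- The coefficients of the boundary kernel `(2 - z) / 2`. -/
def kerCoeff (n : ℕ) : ℂ := 1 * oneCoeff n + -1 / 2 * shiftCoeff oneCoeff n

lemma hbCoeff_ker : HbCoeff (fun z => (2 - z) / 2) kerCoeff fun n => -1 / 2 * oneCoeff n := by
  have h1 : HasCoeff _ kerCoeff := hasCoeff_one.linear hasCoeff_one.shift 1 (-1 / 2)
  refine ⟨h1.congr fun z _ => by ring, ?_, ?_⟩
  · simp_rw [norm_mul, mul_pow]
    exact hasCoeff_one.1.mul_left _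
  · rintro (_ | n) <;> simp [kerCoeff, oneCoeff, shiftCoeff]

lemma memHb_iff_exists_rangeMa {a b₀ : ℂ → ℂ} (ha : ∀ z, a z = (1 + z) / 2)
    (hb₀ : ∀ z, b₀ z = z * (1 - z) / 2) (h : ℂ → ℂ) :
    MemHb b₀ a h ↔
      ∃ g ∈ rangeMa a, ∃ c : ℂ, ∀ z ∈ unitDisk, h z = g z + c * ((2 - z) / 2) := by
  rw [memHb_iff ha hb₀]
  constructor
  · rintro ⟨c, d, hh⟩
    obtain ⟨hc, hd, he⟩ := id hh
    set x : ℕ → ℂ := fun n => 1 * (2 * c n + -1 * c (n + 1)) + -1 * d n with hx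
    have hxs : Summable fun n => ‖x n‖ ^ 2 := summable_norm_sq_linear
      (summable_norm_sq_linear hc.1 ((summable_nat_add_iff 1).2 hc.1) 2 (-1)) hd 1 (-1)
    have hxc : ∀ n, x n + x (n + 1) = 2 * c n := fun n => by
      simp only [hx]
      linear_combination he n
    set q : ℕ → ℂ := fun n => 1 * x (n + 1) + x 0 / 3 * oneCoeff n with hqdef
    have hq : Summable fun n => ‖q n‖ ^ 2 :=
      summable_norm_sq_linear ((summable_nat_add_iff 1).2 hxs) hasCoeff_one.1 1 (x 0 / 3)
    have e : (fun n => 1 * c n + -(x 0 / 3) * kerCoeff n) = mulACoeff q := by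
      funext n
      rcases n with _ | _ | n
      · simp only [mulACoeff, kerCoeff, shiftCoeff, oneCoeff, hqdef, if_true]
        linear_combination (-1 / 2) * hxc 0
      · simp only [mulACoeff, kerCoeff, shiftCoeff, oneCoeff, hqdef, zero_add, one_ne_zero,
          if_true, if_false]
        linear_combination (-1 / 2) * hxc 1
      · simp only [mulACoeff, kerCoeff, shiftCoeff, oneCoeff, hqdef, Nat.add_eq_zero_iff,
          one_ne_zero, and_false, if_false]
        linear_combination (-1 / 2) * hxc (n + 2)
    have hg := hc.linear hbCoeff_ker.1 1 (-(x 0 / 3))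
    rw [e] at hg
    exact ⟨_, (mem_rangeMa_iff ha).2 ⟨q, hq, hg⟩, x 0 / 3, fun z _ => by ring⟩
  · rintro ⟨g, hg, γ, he⟩
    obtain ⟨q, hq, hgq⟩ := (mem_rangeMa_iff ha).1 hg
    exact ⟨_, _, ((hbCoeff_mulA hq hgq).linear hbCoeff_ker 1 γ).congr fun z hz => by
      rw [he z hz]; ring⟩

lemma HbCoeff.hbInner_ker {a b₀ : ℂ → ℂ} (ha : ∀ z, a z = (1 + z) / 2)
    (hb₀ : ∀ z, b₀ z = z * (1 - z) / 2) {h : ℂ → ℂ} {c d : ℕ → ℂ} (hh : HbCoeff h c d) :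
    hbInner b₀ a (fun z => (2 - z) / 2) h = (starRingEnd ℂ) (c 0 - c 1 / 2 - d 0 / 2) := by
  have h1 := (hasSum_bInner hbCoeff_ker.1 hh.1).unique
    (hasSum_sum_of_ne_finset_zero (s := Finset.range 2) fun n hn => by
      obtain ⟨m, rfl⟩ : ∃ m, n = m + 2 := ⟨n - 2, by simp at hn; omega⟩
      simp [kerCoeff, oneCoeff, shiftCoeff])
  have h2 := (hasSum_bInner (hbCoeff_ker.hasCoeff_plusFun ha hb₀)
    (hh.hasCoeff_plusFun ha hb₀)).unique
    (hasSum_single 0 fun n hn => by simp [oneCoeff, hn])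
  rw [hbInner, h1, h2]
  simp [Finset.sum_range_succ, kerCoeff, oneCoeff, shiftCoeff, map_ofNat]
  ring

lemma HbCoeff.hbNormSq_eq {a b₀ : ℂ → ℂ} (ha : ∀ z, a z = (1 + z) / 2)
    (hb₀ : ∀ z, b₀ z = z * (1 - z) / 2) {h : ℂ → ℂ} {c d : ℕ → ℂ} (hh : HbCoeff h c d) :
    hbNormSq b₀ a h = ∑' n, ‖c n‖ ^ 2 + ∑' n, ‖d n‖ ^ 2 := by
  rw [hbNormSq, hbInner, Complex.add_re, hh.1.hasSum_norm_sq.tsum_eq,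
    (hh.hasCoeff_plusFun ha hb₀).hasSum_norm_sq.tsum_eq]

lemma HbCoeff.norm_sq_le_hbNormSq {a b₀ : ℂ → ℂ} (ha : ∀ z, a z = (1 + z) / 2)
    (hb₀ : ∀ z, b₀ z = z * (1 - z) / 2) {h : ℂ → ℂ} {c d : ℕ → ℂ} (hh : HbCoeff h c d) (n : ℕ) :
    ‖c n‖ ^ 2 ≤ hbNormSq b₀ a h ∧ ‖d n‖ ^ 2 ≤ hbNormSq b₀ a h := by
  rw [hh.hbNormSq_eq ha hb₀]
  have hc := hh.1.1.le_tsum n fun _ _ => sq_nonneg _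
  have hd := hh.2.1.le_tsum n fun _ _ => sq_nonneg _
  exact ⟨by linarith [sq_nonneg ‖d n‖], by linarith [sq_nonneg ‖c n‖]⟩

lemma hbClosure_rangeMa {a b₀ : ℂ → ℂ} (ha : ∀ z, a z = (1 + z) / 2)
    (hb₀ : ∀ z, b₀ z = z * (1 - z) / 2) : hbClosure b₀ a (rangeMa a) = rangeMa a := by
  refine Set.Subset.antisymm ?_ fun g hg => ?_
  · rintro h ⟨hm, hcl⟩
    obtain ⟨g, hg, γ, he⟩ := (memHb_iff_exists_rangeMa ha hb₀ h).1 hm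
    obtain ⟨q, hq, hgq⟩ := (mem_rangeMa_iff ha).1 hg
    suffices hγ : γ = 0 by
      refine (mem_rangeMa_iff ha).2 ⟨q, hq, hgq.congr fun z hz => ?_⟩
      rw [he z hz, hγ, zero_mul, add_zero]
    by_contra hγ
    have hγ' : 0 < ‖γ‖ := norm_pos_iff.2 hγ
    obtain ⟨g', hg', hlt⟩ := hcl ((‖γ‖ / 2) ^ 2) (by positivity)
    obtain ⟨q', hq', hgq'⟩ := (mem_rangeMa_iff ha).1 hg'
    obtain ⟨C, D, hF, hCD⟩ : ∃ C D, HbCoeff (fun z => h z - g' z) C D ∧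
        C 0 - C 1 / 2 - D 0 / 2 = 3 / 2 * γ := by
      refine ⟨_, _, (((hbCoeff_mulA hq hgq).linear hbCoeff_ker 1 γ).linear
        (hbCoeff_mulA hq' hgq') 1 (-1)).congr fun z hz => by rw [he z hz]; ring, ?_⟩
      simp only [mulACoeff, kerCoeff, shiftCoeff, oneCoeff, zero_add, one_ne_zero, if_true,
        if_false]
      ring
    have hle := fun n => hF.norm_sq_le_hbNormSq ha hb₀ n
    have h0 := abs_lt_of_sq_lt_sq ((hle 0).1.trans_lt hlt) (by positivity)
    have h1 := abs_lt_of_sq_lt_sq ((hle 1).1.trans_lt hlt) (by positivity)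
    have h2 := abs_lt_of_sq_lt_sq ((hle 0).2.trans_lt hlt) (by positivity)
    rw [abs_norm] at h0 h1 h2
    have h3 := (norm_sub_le (C 0 - C 1 / 2) (D 0 / 2)).trans
      (add_le_add_left (norm_sub_le (C 0) (C 1 / 2)) _)
    rw [hCD] at h3
    simp only [norm_mul, norm_div, Complex.norm_ofNat] at h3
    linarith
  · obtain ⟨q, hq, hgq⟩ := (mem_rangeMa_iff ha).1 hg
    have h1 := hbCoeff_mulA hq hgq
    refine ⟨(memHb_iff ha hb₀).2 ⟨_, _, h1⟩, fun ε hε => ⟨g, hg, ?_⟩⟩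
    have h0 : HbCoeff (fun z => g z - g z) (fun _ => 0) fun _ => 0 :=
      ⟨⟨by simp [summable_zero], fun z _ => by simp⟩, by simp [summable_zero],
        by simp⟩
    rw [h0.hbNormSq_eq ha hb₀]
    simp [hε]

/-- For `a(z) = (1+z)/2` and `b₀(z) = z(1−z)/2`, `M(a)` is a closed
subspace of `H(b₀)` of codimension one, and `H(b₀) = M(a) ⊕ ℂ·k₋₁^{b₀}` with
`k₋₁^{b₀}(z) = (1 − conj(b₀(−1)) b₀(z))/(1+z) = (2−z)/2`. -/
theorem Ma_closed_codim_one (a b₀ : ℂ → ℂ)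
    (ha : ∀ z, a z = (1 + z) / 2)
    (hb₀ : ∀ z, b₀ z = z * (1 - z) / 2) :
    -- `M(a)` is contained in `H(b₀)` and is closed there
    (∀ g ∈ rangeMa a, MemHb b₀ a g) ∧
    hbClosure b₀ a (rangeMa a) = rangeMa a ∧
    -- the kernel identity `k₋₁^{b₀} = (2−z)/2`
    (∀ z ∈ unitDisk,
      (1 - (starRingEnd ℂ) (b₀ (-1)) * b₀ z) / (1 + z) = (2 - z) / 2) ∧
    -- orthogonal decomposition `H(b₀) = M(a) ⊕ ℂ·k₋₁^{b₀}`
    (∀ h : ℂ → ℂ, MemHb b₀ a h ↔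
      ∃ g ∈ rangeMa a, ∃ c : ℂ, ∀ z ∈ unitDisk, h z = g z + c * ((2 - z) / 2)) ∧
    (∀ g ∈ rangeMa a, hbInner b₀ a (fun z => (2 - z) / 2) g = 0) := by
  refine ⟨fun g hg => ?_, hbClosure_rangeMa ha hb₀, fun z hz => ?_,
    memHb_iff_exists_rangeMa ha hb₀, fun g hg => ?_⟩
  · obtain ⟨q, hq, hgq⟩ := (mem_rangeMa_iff ha).1 hg
    exact (memHb_iff ha hb₀).2 ⟨_, _, hbCoeff_mulA hq hgq⟩
  · have hz0 : 1 + z ≠ 0 := fun h => by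
      rw [unitDisk, mem_ball_zero_iff, eq_neg_of_add_eq_zero_right h] at hz
      simp at hz
    have hb : b₀ (-1) = -1 := by rw [hb₀]; norm_num
    rw [hb, hb₀, map_neg, map_one]
    field_simp
    ring
  · obtain ⟨q, hq, hgq⟩ := (mem_rangeMa_iff ha).1 hg
    rw [(hbCoeff_mulA hq hgq).hbInner_ker ha hb₀, map_eq_zero]
    simp only [mulACoeff, shiftCoeff, zero_add]
    ring

end
end

section
/- Let a(z) = (1+z)/2, b₀(z) = z(1−z)/2, I(z) = zB(z) with B a Blaschke product with zeros rₙ ∈ (−1,0) converging to −1, b = I·b₀ and f = a/(1−b). Then the functions f·k_{rₙ}·(I − conj(b₀(rₙ))) converge in H² norm, as n → ∞, to f·k₋₁·(I+1), where k_λ(z) = (1 − λ̄z)^{−1} for λ ∈ 𝔻 and k₋₁(z) = (1+z)^{−1}. -/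
open Complex MeasureTheory Filter Set

noncomputable section

/-- The closed unit disk with the point `-1` removed. -/
def puncturedDisk : Set ℂ := Metric.closedBall 0 1 \ {-1}

/-- The Blaschke product with zeros `r n`, as an everywhere defined function. -/
def blaschke (r : ℕ → ℝ) (z : ℂ) : ℂ := ∏' n, ((z - (r n : ℂ)) / (1 - (r n : ℂ) * z))

lemma mem_puncturedDisk {z : ℂ} : z ∈ puncturedDisk ↔ ‖z‖ ≤ 1 ∧ z ≠ -1 := by
  simp [puncturedDisk]

lemma unitDisk_subset_puncturedDisk : unitDisk ⊆ puncturedDisk := by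
  intro z hz
  simp only [unitDisk, Metric.mem_ball, dist_zero_right] at hz
  refine mem_puncturedDisk.2 ⟨hz.le, ?_⟩
  rintro rfl
  simp at hz

lemma norm_one_add_le_two_mul {t : ℝ} (ht : t ∈ Set.Icc (-1 : ℝ) 0) {z : ℂ} (hz : ‖z‖ ≤ 1) :
    ‖1 + z‖ ≤ 2 * ‖1 - (t : ℂ) * z‖ := by
  obtain ⟨h1, h2⟩ := ht
  have e : 1 + z = (1 - (t : ℂ) * z) + ((1 + t : ℝ) : ℂ) * z := by push_cast; ring
  have n1 : ‖((1 + t : ℝ) : ℂ) * z‖ ≤ 1 + t := by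
    rw [norm_mul, Complex.norm_real, Real.norm_of_nonneg (by linarith)]
    nlinarith [norm_nonneg z]
  have n2 : ‖1 + z‖ ≤ ‖1 - (t : ℂ) * z‖ + ‖((1 + t : ℝ) : ℂ) * z‖ := by
    conv_lhs => rw [e]
    exact norm_add_le _ _
  have n3 : 1 - ‖(t : ℂ) * z‖ ≤ ‖1 - (t : ℂ) * z‖ := by
    simpa using norm_sub_norm_le (1 : ℂ) ((t : ℂ) * z)
  have n4 : ‖(t : ℂ) * z‖ ≤ -t := by
    rw [norm_mul, Complex.norm_real, Real.norm_of_nonpos h2]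
    nlinarith [norm_nonneg z]
  linarith

lemma one_add_ne_zero_of_mem {z : ℂ} (hz : z ∈ puncturedDisk) : 1 + z ≠ 0 := fun h =>
  (mem_puncturedDisk.1 hz).2 (eq_neg_of_add_eq_zero_right h)

lemma one_sub_mul_ne_zero {t : ℝ} (ht : t ∈ Set.Icc (-1 : ℝ) 0) {z : ℂ}
    (hz : z ∈ puncturedDisk) : 1 - (t : ℂ) * z ≠ 0 := by
  intro h
  have := norm_one_add_le_two_mul ht (mem_puncturedDisk.1 hz).1
  rw [h, norm_zero, mul_zero] at this
  exact one_add_ne_zero_of_mem hz (norm_le_zero_iff.1 this)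

lemma blaschke_hasProdUniformlyOn {r : ℕ → ℝ} (hr : ∀ n, r n ∈ Set.Icc (-1 : ℝ) 0)
    (hs : Summable fun n => 1 + r n) {K : Set ℂ} (hK : IsCompact K) (hKs : K ⊆ puncturedDisk) :
    HasProdUniformlyOn (fun n z => (z - (r n : ℂ)) / (1 - (r n : ℂ) * z)) (blaschke r) K := by
  obtain ⟨C, hC⟩ := hK.exists_bound_of_continuousOn (f := fun z : ℂ => (1 + z)⁻¹)
    (ContinuousOn.inv₀ (by fun_prop) fun z hz => one_add_ne_zero_of_mem (hKs hz))
  have key := Summable.hasProdUniformlyOn_nat_one_add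
    (f := fun n z => (z - (r n : ℂ)) / (1 - (r n : ℂ) * z) - 1) hK
    (hs.mul_right (4 * C)) (Eventually.of_forall fun n z hz => ?_) fun n => ?_
  · simp only [add_sub_cancel] at key
    exact key
  · have hz' := mem_puncturedDisk.1 (hKs hz)
    have h0 := one_sub_mul_ne_zero (hr n) (hKs hz)
    have h1 := norm_pos_iff.2 h0
    have h2 := norm_pos_iff.2 (one_add_ne_zero_of_mem (hKs hz))
    have e : (z - (r n : ℂ)) / (1 - (r n : ℂ) * z) - 1
        = ((1 + r n : ℝ) : ℂ) * ((z - 1) / (1 - (r n : ℂ) * z)) := by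
      rw [div_sub_one h0, ← mul_div_assoc]
      push_cast
      ring
    rw [e, norm_mul, Complex.norm_real, Real.norm_of_nonneg (by linarith [(hr n).1])]
    refine mul_le_mul_of_nonneg_left ?_ (by linarith [(hr n).1])
    rw [norm_div, div_le_iff₀ h1]
    have h3 := hC z hz
    rw [norm_inv, inv_le_iff_one_le_mul₀ h2] at h3
    have h4 : ‖z - 1‖ ≤ 2 := (norm_sub_le _ _).trans (by simp; linarith)
    have h5 := norm_one_add_le_two_mul (hr n) hz'.1
    have hC0 : 0 ≤ C := (norm_nonneg _).trans (hC z hz)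
    nlinarith
  · exact ContinuousOn.sub (ContinuousOn.div (by fun_prop) (by fun_prop)
      fun z hz => one_sub_mul_ne_zero (hr n) (hKs hz)) continuousOn_const

lemma blaschke_hasProd {r : ℕ → ℝ} (hr : ∀ n, r n ∈ Set.Icc (-1 : ℝ) 0)
    (hs : Summable fun n => 1 + r n) {z : ℂ} (hz : z ∈ puncturedDisk) :
    HasProd (fun n => (z - (r n : ℂ)) / (1 - (r n : ℂ) * z)) (blaschke r z) :=
  (blaschke_hasProdUniformlyOn hr hs isCompact_singleton
    (Set.singleton_subset_iff.2 hz)).hasProd (Set.mem_singleton z)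

lemma blaschke_continuousOn {r : ℕ → ℝ} (hr : ∀ n, r n ∈ Set.Icc (-1 : ℝ) 0)
    (hs : Summable fun n => 1 + r n) : ContinuousOn (blaschke r) puncturedDisk := by
  intro z hz
  have hpos : 0 < ‖1 + z‖ := norm_pos_iff.2 (one_add_ne_zero_of_mem hz)
  set K : Set ℂ := Metric.closedBall 0 1 ∩ {x | ‖1 + z‖ / 2 ≤ ‖1 + x‖} with hKdef
  have hK : IsCompact K := (isCompact_closedBall 0 1).inter_right
    (isClosed_le continuous_const (by fun_prop))
  have hKs : K ⊆ puncturedDisk := by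
    rintro x ⟨hx1, hx2⟩
    refine ⟨hx1, ?_⟩
    rintro rfl
    simp only [Set.mem_ofPred_eq, add_neg_cancel, norm_zero] at hx2
    linarith
  have hc : ContinuousOn (blaschke r) K := by
    refine (blaschke_hasProdUniformlyOn hr hs hK hKs).tendstoUniformlyOn.continuousOn
      (Frequently.of_forall fun s => ?_)
    refine continuousOn_finsetProd _ fun n _ => ContinuousOn.div (by fun_prop) (by fun_prop)
      fun x hx => one_sub_mul_ne_zero (hr n) (hKs hx)
  have hzK : z ∈ K := ⟨hz.1, by simp only [Set.mem_ofPred_eq]; linarith⟩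
  refine (hc z hzK).mono_of_mem_nhdsWithin ?_
  refine mem_nhdsWithin.2 ⟨{x | ‖1 + z‖ / 2 < ‖1 + x‖},
    isOpen_lt continuous_const (by fun_prop), by simp only [Set.mem_ofPred_eq]; linarith, ?_⟩
  rintro x ⟨hx1, hx2⟩
  exact ⟨hx2.1, le_of_lt (show ‖1 + z‖ / 2 < ‖1 + x‖ from hx1)⟩

lemma blaschke_differentiableOn {r : ℕ → ℝ} (hr : ∀ n, r n ∈ Set.Icc (-1 : ℝ) 0)
    (hs : Summable fun n => 1 + r n) : DifferentiableOn ℂ (blaschke r) unitDisk := by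
  have h := hasProdLocallyUniformlyOn_of_forall_compact (s := unitDisk) Metric.isOpen_ball
    (fun K hK hKc => blaschke_hasProdUniformlyOn hr hs hKc
      (hK.trans unitDisk_subset_puncturedDisk))
  refine (hasProdLocallyUniformlyOn_iff_tendstoLocallyUniformlyOn.1 h).differentiableOn
    (Eventually.of_forall fun s => ?_) Metric.isOpen_ball
  refine DifferentiableOn.fun_finsetProd fun n _ => DifferentiableOn.div (by fun_prop)
    (by fun_prop) fun x hx => one_sub_mul_ne_zero (hr n) (unitDisk_subset_puncturedDisk hx)

lemma normSq_one_sub_sub (t : ℝ) (z : ℂ) :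
    ‖1 - (t : ℂ) * z‖ ^ 2 - ‖z - (t : ℂ)‖ ^ 2 = (1 - t ^ 2) * (1 - ‖z‖ ^ 2) := by
  simp only [← Complex.normSq_eq_norm_sq, Complex.normSq_apply, Complex.sub_re, Complex.sub_im,
    Complex.mul_re, Complex.mul_im, Complex.one_re, Complex.one_im, Complex.ofReal_re,
    Complex.ofReal_im]
  ring

lemma norm_blaschke_le {r : ℕ → ℝ} (hr : ∀ n, r n ∈ Set.Icc (-1 : ℝ) 0)
    (hs : Summable fun n => 1 + r n) {z : ℂ} (hz : z ∈ puncturedDisk) : ‖blaschke r z‖ ≤ 1 := by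
  refine le_of_tendsto (blaschke_hasProd hr hs hz).norm (Eventually.of_forall fun s => ?_)
  refine Finset.prod_le_one (fun _ _ => norm_nonneg _) fun n _ => ?_
  rw [norm_div]
  refine div_le_one_of_le₀ ((sq_le_sq₀ (norm_nonneg _) (norm_nonneg _)).1 ?_)
    (norm_nonneg _)
  have h1 := normSq_one_sub_sub (r n) z
  have h2 : 0 ≤ 1 - ‖z‖ ^ 2 := by nlinarith [(mem_puncturedDisk.1 hz).1, norm_nonneg z]
  have h3 : 0 ≤ 1 - r n ^ 2 := by nlinarith [(hr n).1, (hr n).2]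
  nlinarith [mul_nonneg h3 h2]

lemma norm_blaschke_eq_one {r : ℕ → ℝ} (hr : ∀ n, r n ∈ Set.Icc (-1 : ℝ) 0)
    (hs : Summable fun n => 1 + r n) {z : ℂ} (hz : z ∈ puncturedDisk) (hz1 : ‖z‖ = 1) :
    ‖blaschke r z‖ = 1 := by
  refine tendsto_nhds_unique (blaschke_hasProd hr hs hz).norm ?_
  have e : ∀ n, ‖(z - (r n : ℂ)) / (1 - (r n : ℂ) * z)‖ = 1 := by
    intro n
    have h1 := normSq_one_sub_sub (r n) z
    rw [hz1, one_pow, sub_self, mul_zero, sub_eq_zero] at h1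
    have h2 := (pow_left_inj₀ (norm_nonneg _) (norm_nonneg _) two_ne_zero).1 h1
    rw [norm_div, ← h2, div_self (norm_ne_zero_iff.2 (one_sub_mul_ne_zero (hr n) hz))]
  simpa only [HasProd, e, Finset.prod_const_one, SummationFilter.unconditional_filter] using
    (tendsto_const_nhds : Tendsto (fun _ : Finset ℕ => (1 : ℝ)) atTop (nhds 1))

lemma blaschke_apply_zero (r : ℕ → ℝ) (n : ℕ) : blaschke r (r n) = 0 :=
  tprod_of_exists_eq_zero ⟨n, by simp⟩

/-- The density whose boundary values are `|f|² |α I - β|²` for inner `I`, where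
`f = a / (1 - I b₀)` and `|a|² + |b₀|² = 1` on the circle; it is the real part of a combination
of `α` and `β` with coefficients holomorphic in `I` and `b₀`. -/
def energy (I b α β : ℂ) : ℝ :=
  ((1 - ‖b‖ ^ 2) * ‖α * I - β‖ ^ 2 + (1 - ‖I‖ ^ 2) * ‖α - b * β‖ ^ 2) / ‖1 - I * b‖ ^ 2

lemma energy_nonneg {I b : ℂ} (hI : ‖I‖ ≤ 1) (hb : ‖b‖ ≤ 1) (α β : ℂ) : 0 ≤ energy I b α β := by
  have h1 : 0 ≤ 1 - ‖I‖ ^ 2 := by nlinarith [norm_nonneg I]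
  have h2 : 0 ≤ 1 - ‖b‖ ^ 2 := by nlinarith [norm_nonneg b]
  unfold energy
  positivity

lemma energy_eq_re {I b : ℂ} (h : 1 - I * b ≠ 0) (α β : ℂ) :
    energy I b α β =
      (((1 + I * b) / (1 - I * b) * α - 2 * (b / (1 - I * b)) * β) * (starRingEnd ℂ) α +
        ((1 + I * b) / (1 - I * b) * β - 2 * (I / (1 - I * b)) * α) * (starRingEnd ℂ) β).re := by
  have e : ((1 + I * b) / (1 - I * b) * α - 2 * (b / (1 - I * b)) * β) * (starRingEnd ℂ) α +
        ((1 + I * b) / (1 - I * b) * β - 2 * (I / (1 - I * b)) * α) * (starRingEnd ℂ) β =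
      (((1 + I * b) * α - 2 * b * β) * (starRingEnd ℂ) α +
        ((1 + I * b) * β - 2 * I * α) * (starRingEnd ℂ) β) / (1 - I * b) := by
    ring
  have hn : Complex.normSq (1 - I * b) ≠ 0 := Complex.normSq_eq_zero.not.2 h
  rw [e, energy, Complex.div_re, ← add_div, ← Complex.normSq_eq_norm_sq (1 - I * b)]
  congr 1
  simp only [← Complex.normSq_eq_norm_sq, Complex.normSq_apply, Complex.sub_re, Complex.sub_im,
    Complex.add_re, Complex.add_im, Complex.mul_re, Complex.mul_im, Complex.one_re, Complex.one_im,
    Complex.conj_re, Complex.conj_im, Complex.re_ofNat, Complex.im_ofNat]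
  ring

/-- The value at the real point `t` of the function `z (1 - z) / 2`. -/
def quadVal (t : ℝ) : ℝ := t * (1 - t) / 2

/-- The difference `k_w - k_v` of Szegő kernels. -/
def kerDiff (w v : ℝ) (z : ℂ) : ℂ := (1 - (w : ℂ) * z)⁻¹ - (1 - (v : ℂ) * z)⁻¹

/-- The weighted difference `b₀(w) k_w - b₀(v) k_v` of Szegő kernels, for `b₀(z) = z (1 - z) / 2`. -/
def kerDiffQuad (w v : ℝ) (z : ℂ) : ℂ :=
  (quadVal w : ℂ) * (1 - (w : ℂ) * z)⁻¹ - (quadVal v : ℂ) * (1 - (v : ℂ) * z)⁻¹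

lemma sq_mul_mem_ball {t : ℝ} (ht : t ∈ Set.Icc (-1 : ℝ) 0) {ρ : ℝ} (hρ : ρ ∈ Set.Ioo (0 : ℝ) 1) :
    ((ρ ^ 2 * t : ℝ) : ℂ) ∈ Metric.ball (0 : ℂ) ρ := by
  obtain ⟨h0, h1⟩ := hρ
  obtain ⟨h2, h3⟩ := ht
  rw [mem_ball_zero_iff, Complex.norm_real, Real.norm_eq_abs, abs_lt]
  constructor <;> nlinarith [pow_pos h0 2]

lemma closedBall_subset_unitDisk {ρ : ℝ} (hρ : ρ < 1) : Metric.closedBall (0 : ℂ) ρ ⊆ unitDisk :=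
  Metric.closedBall_subset_ball hρ

lemma sphere_subset_unitDisk {ρ : ℝ} (hρ : ρ < 1) : Metric.sphere (0 : ℂ) ρ ⊆ unitDisk :=
  Metric.sphere_subset_closedBall.trans (closedBall_subset_unitDisk hρ)

lemma kernel_differentiableOn {t : ℝ} (ht : t ∈ Set.Icc (-1 : ℝ) 0) :
    DifferentiableOn ℂ (fun z => (1 - (t : ℂ) * z)⁻¹) unitDisk :=
  DifferentiableOn.inv (by fun_prop) fun _ hz =>
    one_sub_mul_ne_zero ht (unitDisk_subset_puncturedDisk hz)

lemma circleAverage_mul_conj_kernel {H : ℂ → ℂ} (hH : DifferentiableOn ℂ H unitDisk)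
    {t : ℝ} (ht : t ∈ Set.Icc (-1 : ℝ) 0) {ρ : ℝ} (hρ : ρ ∈ Set.Ioo (0 : ℝ) 1) :
    Real.circleAverage (fun z => H z * (starRingEnd ℂ) (1 - (t : ℂ) * z)⁻¹) 0 ρ =
      H ((ρ ^ 2 * t : ℝ) : ℂ) := by
  have hd : DiffContOnCl ℂ H (Metric.ball 0 |ρ|) := by
    rw [abs_of_pos hρ.1]
    refine DifferentiableOn.diffContOnCl (hH.mono ?_)
    exact Metric.closure_ball_subset_closedBall.trans (closedBall_subset_unitDisk hρ.2)
  rw [← hd.circleAverage_smul_div (w := ((ρ ^ 2 * t : ℝ) : ℂ))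
    (by rw [abs_of_pos hρ.1]; exact sq_mul_mem_ball ht hρ)]
  refine Real.circleAverage_congr_sphere fun z hz => ?_
  rw [abs_of_pos hρ.1] at hz
  have hz1 : ‖z‖ = ρ := mem_sphere_zero_iff_norm.1 hz
  have hz0 : z ≠ 0 := norm_pos_iff.1 (hz1 ▸ hρ.1)
  have hzz : z * (starRingEnd ℂ) z = ((ρ ^ 2 : ℝ) : ℂ) := by
    rw [Complex.mul_conj, Complex.normSq_eq_norm_sq, hz1]
  have h1 : 1 - (t : ℂ) * (starRingEnd ℂ) z ≠ 0 := by
    have := one_sub_mul_ne_zero ht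
      (unitDisk_subset_puncturedDisk (sphere_subset_unitDisk hρ.2 hz))
    simpa using (map_ne_zero (starRingEnd ℂ)).2 this
  have h2 : z - ((ρ ^ 2 * t : ℝ) : ℂ) = z * (1 - (t : ℂ) * (starRingEnd ℂ) z) := by
    rw [Complex.ofReal_mul, ← hzz]; ring
  simp only [smul_eq_mul, sub_zero, map_inv₀, map_sub, map_one, map_mul, Complex.conj_ofReal]
  rw [h2, div_mul_cancel_left₀ hz0, mul_comm]

/-- The holomorphic function whose values at the base points compute circle means of `energy`. -/
def energyPot (I b α β : ℂ → ℂ) (c : ℝ) (z : ℂ) : ℂ :=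
  ((1 + I z * b z) / (1 - I z * b z) * α z - 2 * (b z / (1 - I z * b z)) * β z) +
    c * ((1 + I z * b z) / (1 - I z * b z) * β z - 2 * (I z / (1 - I z * b z)) * α z)

lemma energyPot_differentiableOn {I b α β : ℂ → ℂ} (hI : DifferentiableOn ℂ I unitDisk)
    (hb : DifferentiableOn ℂ b unitDisk) (hα : DifferentiableOn ℂ α unitDisk)
    (hβ : DifferentiableOn ℂ β unitDisk) (h : ∀ z ∈ unitDisk, 1 - I z * b z ≠ 0) (c : ℝ) :
    DifferentiableOn ℂ (energyPot I b α β c) unitDisk := by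
  unfold energyPot
  fun_prop (disch := assumption)

lemma kerDiff_differentiableOn {w v : ℝ} (hw : w ∈ Set.Icc (-1 : ℝ) 0)
    (hv : v ∈ Set.Icc (-1 : ℝ) 0) : DifferentiableOn ℂ (kerDiff w v) unitDisk :=
  (kernel_differentiableOn hw).sub (kernel_differentiableOn hv)

lemma kerDiffQuad_differentiableOn {w v : ℝ} (hw : w ∈ Set.Icc (-1 : ℝ) 0)
    (hv : v ∈ Set.Icc (-1 : ℝ) 0) : DifferentiableOn ℂ (kerDiffQuad w v) unitDisk :=
  ((kernel_differentiableOn hw).const_mul _).sub ((kernel_differentiableOn hv).const_mul _)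

lemma circleAverage_energy {I b : ℂ → ℂ} (hI : DifferentiableOn ℂ I unitDisk)
    (hb : DifferentiableOn ℂ b unitDisk) (h : ∀ z ∈ unitDisk, 1 - I z * b z ≠ 0)
    {w v : ℝ} (hw : w ∈ Set.Icc (-1 : ℝ) 0) (hv : v ∈ Set.Icc (-1 : ℝ) 0)
    {ρ : ℝ} (hρ : ρ ∈ Set.Ioo (0 : ℝ) 1) :
    Real.circleAverage (fun z => energy (I z) (b z) (kerDiff w v z) (kerDiffQuad w v z)) 0 ρ =
      (energyPot I b (kerDiff w v) (kerDiffQuad w v) (quadVal w) ((ρ ^ 2 * w : ℝ) : ℂ) -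
        energyPot I b (kerDiff w v) (kerDiffQuad w v) (quadVal v) ((ρ ^ 2 * v : ℝ) : ℂ)).re := by
  have hP := energyPot_differentiableOn hI hb (kerDiff_differentiableOn hw hv)
    (kerDiffQuad_differentiableOn hw hv) h
  have hsph : Metric.sphere (0 : ℂ) |ρ| ⊆ unitDisk := by
    rw [abs_of_pos hρ.1]; exact sphere_subset_unitDisk hρ.2
  have hint : ∀ t ∈ Set.Icc (-1 : ℝ) 0, CircleIntegrable
      (fun z => energyPot I b (kerDiff w v) (kerDiffQuad w v) (quadVal t) z *
        (starRingEnd ℂ) (1 - (t : ℂ) * z)⁻¹) 0 ρ := fun t ht => by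
    refine ContinuousOn.circleIntegrable' (ContinuousOn.mul ((hP _).continuousOn.mono hsph) ?_)
    exact Complex.continuous_conj.comp_continuousOn
      ((kernel_differentiableOn ht).continuousOn.mono hsph)
  rw [← circleAverage_mul_conj_kernel (hP (quadVal w)) hw hρ,
    ← circleAverage_mul_conj_kernel (hP (quadVal v)) hv hρ,
    ← Real.circleAverage_sub (hint w hw) (hint v hv), ← Complex.reCLM_apply,
    ← Complex.reCLM.circleAverage_comp_comm ((hint w hw).sub (hint v hv))]
  refine Real.circleAverage_congr_sphere fun z hz => ?_
  simp only [Function.comp_apply, Complex.reCLM_apply, Pi.sub_apply]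
  rw [energy_eq_re (h z (hsph hz))]
  congr 1
  simp only [energyPot, kerDiff, kerDiffQuad, map_sub, map_mul, Complex.conj_ofReal]
  ring

/-- The kernel `(1 - b₀(w) b₀(v)) / (1 - w v)` of `H(b₀)` at real points. -/
def quadKernel (w v : ℝ) : ℝ := (1 - quadVal w * quadVal v) / (1 - w * v)

lemma tendsto_circleAverage_energy {I b : ℂ → ℂ} (hI : DifferentiableOn ℂ I unitDisk)
    (hb : DifferentiableOn ℂ b unitDisk) (h : ∀ z ∈ unitDisk, 1 - I z * b z ≠ 0)
    {w v : ℝ} (hw : w ∈ Set.Ioo (-1 : ℝ) 0) (hv : v ∈ Set.Ioo (-1 : ℝ) 0)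
    (hIw : I w = 0) (hIv : I v = 0) (hbw : b w = quadVal w) (hbv : b v = quadVal v) :
    Tendsto (fun ρ => Real.circleAverage
        (fun z => energy (I z) (b z) (kerDiff w v z) (kerDiffQuad w v z)) 0 ρ)
      (nhdsWithin 1 (Set.Iio 1))
      (nhds (quadKernel w w + quadKernel v v - 2 * quadKernel w v)) := by
  have hw' := Set.Ioo_subset_Icc_self hw
  have hv' := Set.Ioo_subset_Icc_self hv
  have hP := energyPot_differentiableOn hI hb (kerDiff_differentiableOn hw' hv')
    (kerDiffQuad_differentiableOn hw' hv') h
  have aux : ∀ t ∈ Set.Ioo (-1 : ℝ) 0, Tendsto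
      (fun ρ : ℝ => energyPot I b (kerDiff w v) (kerDiffQuad w v) (quadVal t) ((ρ ^ 2 * t : ℝ) : ℂ))
      (nhdsWithin 1 (Set.Iio 1))
      (nhds (energyPot I b (kerDiff w v) (kerDiffQuad w v) (quadVal t) t)) := by
    intro t ht
    have hmem : (t : ℂ) ∈ unitDisk := by
      rw [unitDisk, mem_ball_zero_iff, Complex.norm_real, Real.norm_eq_abs, abs_lt]
      exact ⟨ht.1, ht.2.trans one_pos⟩
    have hc := ((hP (quadVal t)).differentiableAt (Metric.isOpen_ball.mem_nhds hmem)).continuousAt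
    refine hc.tendsto.comp (Tendsto.mono_left ?_ nhdsWithin_le_nhds)
    have : Continuous fun ρ : ℝ => ((ρ ^ 2 * t : ℝ) : ℂ) := by fun_prop
    simpa using this.tendsto 1
  have key := Complex.continuous_re.continuousAt.tendsto.comp ((aux w hw).sub (aux v hv))
  have hww : 1 - w * w ≠ 0 := by nlinarith [hw.1, hw.2]
  have hvv : 1 - v * v ≠ 0 := by nlinarith [hv.1, hv.2]
  have hwv : 1 - w * v ≠ 0 := by nlinarith [hw.1, hw.2, hv.1, hv.2]
  have e : (energyPot I b (kerDiff w v) (kerDiffQuad w v) (quadVal w) w -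
      energyPot I b (kerDiff w v) (kerDiffQuad w v) (quadVal v) v).re =
      quadKernel w w + quadKernel v v - 2 * quadKernel w v := by
    have e1 : energyPot I b (kerDiff w v) (kerDiffQuad w v) (quadVal w) w -
      energyPot I b (kerDiff w v) (kerDiffQuad w v) (quadVal v) v =
      ((quadKernel w w + quadKernel v v - 2 * quadKernel w v : ℝ) : ℂ) := by
      simp only [energyPot, hIw, hIv, hbw, hbv, kerDiff, kerDiffQuad, quadKernel]
      push_cast
      rw [mul_comm (v : ℂ) w]
      ring
    rw [e1, Complex.ofReal_re]
  rw [e] at key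
  refine key.congr' ?_
  filter_upwards [Ioo_mem_nhdsLT (zero_lt_one' ℝ)] with ρ hρ
  exact (circleAverage_energy hI hb h hw' hv' hρ).symm

lemma tendsto_quadKernel_right {ι : Type*} {l : Filter ι} {v : ι → ℝ} (hv : Tendsto v l (nhds (-1)))
    {w : ℝ} (hw : -1 < w) : Tendsto (fun n => quadKernel w (v n)) l (nhds (1 - w / 2)) := by
  have hc : ContinuousAt (fun t => quadKernel w t) (-1) := by
    unfold quadKernel quadVal
    refine ContinuousAt.div (by fun_prop) (by fun_prop) (by linarith)
  have e : quadKernel w (-1) = 1 - w / 2 := by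
    have : 1 - w * -1 ≠ 0 := by linarith
    unfold quadKernel quadVal
    rw [div_eq_iff this]
    ring
  exact e ▸ hc.tendsto.comp hv

lemma tendsto_quadKernel_self {ι : Type*} {l : Filter ι} {v : ι → ℝ} (hv : Tendsto v l (nhds (-1)))
    (hv1 : ∀ n, v n ∈ Set.Ioo (-1 : ℝ) 0) :
    Tendsto (fun n => quadKernel (v n) (v n)) l (nhds (3 / 2)) := by
  have hc : ContinuousAt (fun t : ℝ => (2 - t) * (2 - t + t ^ 2) / (4 * (1 - t))) (-1) :=
    ContinuousAt.div (by fun_prop) (by fun_prop) (by norm_num)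
  have := hc.tendsto.comp hv
  norm_num at this
  refine this.congr fun n => ?_
  have h1 : 1 - v n ≠ 0 := by linarith [(hv1 n).2]
  have h2 : 1 - v n * v n ≠ 0 := by nlinarith [(hv1 n).1, (hv1 n).2]
  simp only [Function.comp_apply, quadKernel, quadVal]
  rw [div_eq_div_iff (mul_ne_zero four_ne_zero h1) h2]
  ring

lemma integral_le_of_tendsto_ae {α : Type*} [MeasurableSpace α] {μ : Measure α}
    {G : ℕ → α → ℝ} {F : α → ℝ} {A : ℕ → ℝ} {L : ℝ} (hG : ∀ m, Integrable (G m) μ)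
    (hG0 : ∀ m x, 0 ≤ G m x) (hlim : ∀ᵐ x ∂μ, Tendsto (fun m => G m x) atTop (nhds (F x)))
    (hGA : ∀ m, ∫ x, G m x ∂μ ≤ A m) (hA : Tendsto A atTop (nhds L)) : ∫ x, F x ∂μ ≤ L := by
  have hL : 0 ≤ L := ge_of_tendsto' hA fun m => (integral_nonneg (hG0 m)).trans (hGA m)
  by_cases hF : Integrable F μ
  swap
  · rwa [integral_undef hF]
  have hF0 : 0 ≤ᵐ[μ] F := hlim.mono fun x hx => ge_of_tendsto' hx fun m => hG0 m x
  rw [← ENNReal.ofReal_le_ofReal_iff hL, ofReal_integral_eq_lintegral_ofReal hF hF0]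
  calc ∫⁻ x, ENNReal.ofReal (F x) ∂μ
      = ∫⁻ x, liminf (fun m => ENNReal.ofReal (G m x)) atTop ∂μ := by
        refine lintegral_congr_ae (hlim.mono fun x hx => ?_)
        exact ((ENNReal.continuous_ofReal.tendsto _).comp hx).liminf_eq.symm
    _ ≤ liminf (fun m => ∫⁻ x, ENNReal.ofReal (G m x) ∂μ) atTop :=
        lintegral_liminf_le' fun m => (hG m).aestronglyMeasurable.aemeasurable.ennreal_ofReal
    _ ≤ liminf (fun m => ENNReal.ofReal (A m)) atTop := by
        refine liminf_le_liminf (Eventually.of_forall fun m => ?_)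
        rw [← ofReal_integral_eq_lintegral_ofReal (hG m) (Eventually.of_forall (hG0 m))]
        exact ENNReal.ofReal_le_ofReal (hGA m)
    _ = ENNReal.ofReal L := ((ENNReal.continuous_ofReal.tendsto _).comp hA).liminf_eq

lemma ae_uc_ne_neg_one : ∀ᵐ θ : ℝ, uc θ ≠ -1 := by
  have hc : (Set.range fun n : ℤ => Real.pi + n * (2 * Real.pi)).Countable := Set.countable_range _
  refine measure_mono_null (fun θ hθ => ?_) (hc.measure_zero volume)
  have h : Complex.exp ((θ : ℂ) * Complex.I) = Complex.exp ((Real.pi : ℂ) * Complex.I) := by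
    rw [Complex.exp_pi_mul_I]
    exact not_not.1 hθ
  obtain ⟨n, hn⟩ := Complex.exp_eq_exp_iff_exists_int.1 h
  refine ⟨n, ?_⟩
  have h2 : (θ : ℂ) * Complex.I =
      ((Real.pi + n * (2 * Real.pi) : ℝ) : ℂ) * Complex.I := by
    rw [hn]; push_cast; ring
  exact_mod_cast (mul_right_cancel₀ Complex.I_ne_zero h2).symm

lemma real_mul_uc_mem_unitDisk {ρ : ℝ} (hρ : ρ ∈ Set.Ioo (0 : ℝ) 1) (θ : ℝ) :
    (ρ : ℂ) * uc θ ∈ unitDisk := by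
  rw [unitDisk, mem_ball_zero_iff, norm_mul, norm_uc, mul_one, Complex.norm_real,
    Real.norm_of_nonneg hρ.1.le]
  exact hρ.2

lemma tendsto_real_mul_uc {ι : Type*} {l : Filter ι} {ρ : ι → ℝ} (hρ : Tendsto ρ l (nhds 1))
    (hρ1 : ∀ᶠ i in l, ρ i ∈ Set.Ioo (0 : ℝ) 1) (θ : ℝ) :
    Tendsto (fun i => (ρ i : ℂ) * uc θ) l (nhdsWithin (uc θ) puncturedDisk) := by
  refine tendsto_nhdsWithin_iff.2 ⟨?_, hρ1.mono fun i hi =>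
    unitDisk_subset_puncturedDisk (real_mul_uc_mem_unitDisk hi θ)⟩
  have h : Continuous fun x : ℝ => (x : ℂ) * uc θ := by fun_prop
  simpa [Function.comp_def] using (h.tendsto 1).comp hρ

lemma bdry_eq_of_continuousWithinAt {g G : ℂ → ℂ} (hgG : Set.EqOn g G unitDisk) {θ : ℝ}
    (hG : ContinuousWithinAt G puncturedDisk (uc θ)) : bdry g θ = G (uc θ) := by
  have hmem : ∀ᶠ ρ in nhdsWithin (1 : ℝ) (Set.Iio 1), ρ ∈ Set.Ioo (0 : ℝ) 1 :=
    Ioo_mem_nhdsLT zero_lt_one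
  have h := hG.tendsto.comp (tendsto_real_mul_uc
    (tendsto_id'.2 nhdsWithin_le_nhds) hmem θ)
  refine Tendsto.limUnder_eq (h.congr' (hmem.mono fun ρ hρ => ?_))
  exact (hgG (real_mul_uc_mem_unitDisk hρ θ)).symm

lemma norm_one_sub_sq_add_norm_one_add_sq (z : ℂ) :
    ‖1 - z‖ ^ 2 + ‖1 + z‖ ^ 2 = 2 + 2 * ‖z‖ ^ 2 := by
  simp only [← Complex.normSq_eq_norm_sq, Complex.normSq_apply, Complex.sub_re, Complex.sub_im,
    Complex.add_re, Complex.add_im, Complex.one_re, Complex.one_im]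
  ring

lemma norm_quad_lt {z : ℂ} (hz : z ∈ puncturedDisk) : ‖z * (1 - z) / 2‖ < 1 := by
  obtain ⟨h1, h2⟩ := mem_puncturedDisk.1 hz
  have h3 := norm_one_sub_sq_add_norm_one_add_sq z
  have h4 : 0 < ‖1 + z‖ := norm_pos_iff.2 (one_add_ne_zero_of_mem hz)
  have h5 : ‖1 - z‖ < 2 := by nlinarith [norm_nonneg z, norm_nonneg (1 - z)]
  rw [norm_div, norm_mul, RCLike.norm_ofNat]
  nlinarith [norm_nonneg z, norm_nonneg (1 - z)]

lemma one_sub_mul_quad_ne_zero {z : ℂ} (hz : z ∈ puncturedDisk) {x : ℂ} (hx : ‖x‖ ≤ 1) :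
    1 - x * (z * (1 - z) / 2) ≠ 0 := fun h => by
  have h1 : ‖x * (z * (1 - z) / 2)‖ = 1 := by rw [← sub_eq_zero.1 h, norm_one]
  rw [norm_mul] at h1
  nlinarith [norm_quad_lt hz, norm_nonneg x, norm_nonneg (z * (1 - z) / 2)]

lemma norm_sq_quad {z : ℂ} (hz : ‖z‖ = 1) :
    1 - ‖z * (1 - z) / 2‖ ^ 2 = ‖(1 + z) / 2‖ ^ 2 := by
  have h3 := norm_one_sub_sq_add_norm_one_add_sq z
  rw [hz] at h3
  rw [norm_div, norm_div, norm_mul, RCLike.norm_ofNat, hz]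
  linarith

lemma quadVal_cast (t : ℝ) : (quadVal t : ℂ) = (t : ℂ) * (1 - (t : ℂ)) / 2 := by
  simp [quadVal]

/-- The bound of the boundary energy by Fatou's lemma along radii tending to `1` and real points
`r m` tending to `-1`. -/
lemma integral_energy_le {r : ℕ → ℝ} (hr : ∀ n, r n ∈ Set.Ioo (-1 : ℝ) 0)
    (hrlim : Tendsto r atTop (nhds (-1))) {I : ℂ → ℂ} (hI : DifferentiableOn ℂ I unitDisk)
    (hIc : ContinuousOn I puncturedDisk) (hI1 : ∀ z ∈ puncturedDisk, ‖I z‖ ≤ 1)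
    (hI0 : ∀ n, I (r n) = 0) (n : ℕ) :
    ∫ θ in (0 : ℝ)..(2 * Real.pi), energy (I (uc θ)) (uc θ * (1 - uc θ) / 2)
        (kerDiff (r n) (-1) (uc θ)) (kerDiffQuad (r n) (-1) (uc θ)) ≤
      2 * Real.pi * (quadKernel (r n) (r n) + 3 / 2 - 2 * (1 - r n / 2)) := by
  set w := r n
  have hne : ∀ z ∈ puncturedDisk, 1 - I z * (z * (1 - z) / 2) ≠ 0 :=
    fun z hz => one_sub_mul_quad_ne_zero hz (hI1 z hz)
  have hbd : DifferentiableOn ℂ (fun z : ℂ => z * (1 - z) / 2) unitDisk := by fun_prop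
  have hne' := fun z hz => hne z (unitDisk_subset_puncturedDisk hz)
  have hex : ∀ m : ℕ, ∃ ρ : ℝ, ρ ∈ Set.Ioo (0 : ℝ) 1 ∧ 1 - 1 / ((m : ℝ) + 1) < ρ ∧
      Real.circleAverage (fun z => energy (I z) (z * (1 - z) / 2) (kerDiff w (r m) z)
        (kerDiffQuad w (r m) z)) 0 ρ <
        quadKernel w w + quadKernel (r m) (r m) - 2 * quadKernel w (r m) + 1 / ((m : ℝ) + 1) := by
    intro m
    have hpos : 0 < 1 / ((m : ℝ) + 1) := Nat.one_div_pos_of_nat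
    have ht := tendsto_circleAverage_energy hI hbd hne' (hr n) (hr m) (hI0 n) (hI0 m)
      (quadVal_cast _).symm (quadVal_cast _).symm
    have h1 := ht.eventually_lt_const (lt_add_of_pos_right _ hpos)
    have h2 : ∀ᶠ ρ in nhdsWithin (1 : ℝ) (Set.Iio 1), ρ ∈ Set.Ioo (0 : ℝ) 1 :=
      Ioo_mem_nhdsLT zero_lt_one
    have h3 : ∀ᶠ ρ in nhdsWithin (1 : ℝ) (Set.Iio 1), 1 - 1 / ((m : ℝ) + 1) < ρ :=
      nhdsWithin_le_nhds (lt_mem_nhds (by linarith))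
    obtain ⟨ρ, ha, hb, hc⟩ := (h1.and (h2.and h3)).exists
    exact ⟨ρ, hb, hc, ha⟩
  choose ρ hρ hρ1 hρA using hex
  have hinv : Tendsto (fun m : ℕ => 1 / ((m : ℝ) + 1)) atTop (nhds 0) :=
    tendsto_one_div_add_atTop_nhds_zero_nat
  have hρlim : Tendsto ρ atTop (nhds 1) := by
    refine tendsto_of_tendsto_of_tendsto_of_le_of_le (g := fun m : ℕ => 1 - 1 / ((m : ℝ) + 1))
      (by simpa using hinv.const_sub 1) tendsto_const_nhds (fun m => (hρ1 m).le)
      fun m => (hρ m).2.le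
  have hker : ∀ v ∈ Set.Icc (-1 : ℝ) 0, ContinuousOn (fun z => (1 - (v : ℂ) * z)⁻¹) puncturedDisk :=
    fun v hv => ContinuousOn.inv₀ (by fun_prop) fun z hz => one_sub_mul_ne_zero hv hz
  have hw' := Set.Ioo_subset_Icc_self (hr n)
  rw [intervalIntegral.integral_of_le Real.two_pi_pos.le]
  refine integral_le_of_tendsto_ae (A := fun m => 2 * Real.pi *
      (quadKernel w w + quadKernel (r m) (r m) - 2 * quadKernel w (r m) + 1 / ((m : ℝ) + 1)))
    (G := fun m θ => energy (I (ρ m * uc θ)) (ρ m * uc θ * (1 - ρ m * uc θ) / 2)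
      (kerDiff w (r m) (ρ m * uc θ)) (kerDiffQuad w (r m) (ρ m * uc θ))) ?_ ?_ ?_ ?_ ?_
  · intro m
    have huc : Continuous fun θ => (ρ m : ℂ) * uc θ := by unfold uc; fun_prop
    have hmaps : ∀ θ, (ρ m : ℂ) * uc θ ∈ puncturedDisk := fun θ =>
      unitDisk_subset_puncturedDisk (real_mul_uc_mem_unitDisk (hρ m) θ)
    have hr' := Set.Ioo_subset_Icc_self (hr m)
    have c1 := hIc.comp_continuous huc hmaps
    have c2 := (hker w hw').comp_continuous huc hmaps
    have c3 := (hker (r m) hr').comp_continuous huc hmaps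
    have hc : Continuous fun θ => energy (I (ρ m * uc θ)) (ρ m * uc θ * (1 - ρ m * uc θ) / 2)
      (kerDiff w (r m) (ρ m * uc θ)) (kerDiffQuad w (r m) (ρ m * uc θ)) := by
      have c5 : Continuous fun θ => (ρ m : ℂ) * uc θ * (1 - ρ m * uc θ) / 2 :=
        (huc.mul (continuous_const.sub huc)).div_const 2
      have cα := c2.sub c3
      have cβ := (c2.const_mul (quadVal w : ℂ)).sub (c3.const_mul (quadVal (r m) : ℂ))
      refine Continuous.div (Continuous.add ?_ ?_) ((continuous_const.sub (c1.mul c5)).norm.pow 2)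
        fun θ => pow_ne_zero 2 (norm_ne_zero_iff.2 (hne _ (hmaps θ)))
      · exact (continuous_const.sub (c5.norm.pow 2)).mul (((cα.mul c1).sub cβ).norm.pow 2)
      · exact (continuous_const.sub (c1.norm.pow 2)).mul ((cα.sub (c5.mul cβ)).norm.pow 2)
    exact (hc.integrableOn_Icc).mono_set Set.Ioc_subset_Icc_self
  · intro m θ
    have hmem := unitDisk_subset_puncturedDisk (real_mul_uc_mem_unitDisk (hρ m) θ)
    exact energy_nonneg (hI1 _ hmem) (norm_quad_lt hmem).le _ _
  · filter_upwards [ae_restrict_of_ae ae_uc_ne_neg_one] with θ hθ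
    have hmem : uc θ ∈ puncturedDisk := mem_puncturedDisk.2 ⟨(norm_uc θ).le, hθ⟩
    have ht := tendsto_real_mul_uc hρlim (Eventually.of_forall hρ) θ
    have t0 : Tendsto (fun m => (ρ m : ℂ) * uc θ) atTop (nhds (uc θ)) :=
      ht.mono_right nhdsWithin_le_nhds
    have t1 := (hIc _ hmem).tendsto.comp ht
    have t2 := (hker w hw' _ hmem).tendsto.comp ht
    have hr1 : Tendsto (fun m => (r m : ℂ)) atTop (nhds ((-1 : ℝ) : ℂ)) :=
      (Complex.continuous_ofReal.tendsto _).comp hrlim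
    have t3 : Tendsto (fun m => (1 - (r m : ℂ) * (ρ m * uc θ))⁻¹) atTop
        (nhds ((1 - ((-1 : ℝ) : ℂ) * uc θ)⁻¹)) :=
      ((hr1.mul t0).const_sub 1).inv₀ (one_sub_mul_ne_zero (by norm_num) hmem)
    have t4 : Tendsto (fun m => (quadVal (r m) : ℂ)) atTop (nhds ((quadVal (-1) : ℝ) : ℂ)) := by
      have : Continuous fun t => ((quadVal t : ℝ) : ℂ) := by unfold quadVal; fun_prop
      exact (this.tendsto _).comp hrlim
    have t5 := (t0.mul (t0.const_sub 1)).div_const 2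
    have tα := t2.sub t3
    have tβ := (t2.const_mul (quadVal w : ℂ)).sub (t4.mul t3)
    refine Tendsto.div (Tendsto.add ?_ ?_) ?_
      (pow_ne_zero 2 (norm_ne_zero_iff.2 (hne _ hmem)))
    · exact ((t5.norm.pow 2).const_sub 1).mul (((tα.mul t1).sub tβ).norm.pow 2)
    · exact ((t1.norm.pow 2).const_sub 1).mul ((tα.sub (t5.mul tβ)).norm.pow 2)
    · exact ((t1.mul t5).const_sub 1).norm.pow 2
  · intro m
    have h := (hρA m).le
    rw [Real.circleAverage_def, smul_eq_mul, inv_mul_le_iff₀ Real.two_pi_pos,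
      intervalIntegral.integral_of_le Real.two_pi_pos.le] at h
    simp only [circleMap, zero_add] at h
    exact h
  · refine Tendsto.const_mul _ ?_
    simpa using (((tendsto_quadKernel_self hrlim hr).const_add (quadKernel w w)).sub
      ((tendsto_quadKernel_right hrlim (hr n).1).const_mul 2)).add hinv

/-- In the setting of the Example (`a(z) = (1+z)/2`,
`b₀(z) = z(1−z)/2`, `I = zB` with `B` the Blaschke product with zeros `rₙ ∈ (−1,0)`,
`rₙ → −1`, `b = I·b₀`, `f = a/(1−b)`), the functions `f·k_{rₙ}·(I − conj(b₀(rₙ)))`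
converge in `H²` norm to `f·k₋₁·(I+1)`, where `k₋₁(z) = (1+z)⁻¹`. -/
theorem strong_convergence_to_spanning_function (r : ℕ → ℝ)
    (hr : ∀ n, r n ∈ Set.Ioo (-1 : ℝ) 0)
    (hrlim : Filter.Tendsto r Filter.atTop (nhds (-1)))
    (hblaschke : Summable fun n => 1 + r n)
    (B a b₀ I f : ℂ → ℂ)
    (hB : ∀ z ∈ unitDisk, B z = ∏' n, ((z - (r n : ℂ)) / (1 - (r n : ℂ) * z)))
    (ha : ∀ z, a z = (1 + z) / 2)
    (hb₀ : ∀ z, b₀ z = z * (1 - z) / 2)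
    (hI : ∀ z, I z = z * B z)
    (hf : ∀ z, f z = a z / (1 - I z * b₀ z)) :
    Filter.Tendsto
      (fun n => bNormSq (fun z =>
        f z * szKernel ((r n : ℝ) : ℂ) z * (I z - (starRingEnd ℂ) (b₀ ((r n : ℝ) : ℂ)))
          - f z * (1 + z)⁻¹ * (I z + 1)))
      Filter.atTop (nhds 0) := by

  have hr' : ∀ n, r n ∈ Set.Icc (-1 : ℝ) 0 := fun n => Set.Ioo_subset_Icc_self (hr n)
  set J : ℂ → ℂ := fun z => z * blaschke r z with hJ
  have hIJ : Set.EqOn I J unitDisk := fun z hz => by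
    rw [hI, hB z hz]
    rfl
  have hJd : DifferentiableOn ℂ J unitDisk :=
    differentiableOn_id.mul (blaschke_differentiableOn hr' hblaschke)
  have hJc : ContinuousOn J puncturedDisk :=
    continuousOn_id.mul (blaschke_continuousOn hr' hblaschke)
  have hJ1 : ∀ z ∈ puncturedDisk, ‖J z‖ ≤ 1 := fun z hz => by
    rw [hJ, norm_mul]
    exact mul_le_one₀ (mem_puncturedDisk.1 hz).1 (norm_nonneg _) (norm_blaschke_le hr' hblaschke hz)
  have hJ0 : ∀ n, J (r n) = 0 := fun n => by
    rw [hJ]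
    simp only [blaschke_apply_zero, mul_zero]
  have hne : ∀ z ∈ puncturedDisk, 1 - J z * (z * (1 - z) / 2) ≠ 0 :=
    fun z hz => one_sub_mul_quad_ne_zero hz (hJ1 z hz)
  have hbound : ∀ n, bNormSq (fun z =>
        f z * szKernel ((r n : ℝ) : ℂ) z * (I z - (starRingEnd ℂ) (b₀ ((r n : ℝ) : ℂ)))
          - f z * (1 + z)⁻¹ * (I z + 1)) ≤
      quadKernel (r n) (r n) + 3 / 2 - 2 * (1 - r n / 2) := by
    intro n
    set G : ℂ → ℂ := fun z => (1 + z) / 2 / (1 - J z * (z * (1 - z) / 2)) *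
      (kerDiff (r n) (-1) z * J z - kerDiffQuad (r n) (-1) z) with hG
    have hEq : Set.EqOn (fun z =>
        f z * szKernel ((r n : ℝ) : ℂ) z * (I z - (starRingEnd ℂ) (b₀ ((r n : ℝ) : ℂ)))
          - f z * (1 + z)⁻¹ * (I z + 1)) G unitDisk := by
      intro z hz
      have hq : (quadVal (-1) : ℂ) = -1 := by norm_num [quadVal]
      simp only [hG, hf, ha, hb₀, hIJ hz, szKernel, Complex.conj_ofReal, kerDiff, kerDiffQuad, hq,
        ← quadVal_cast, Complex.ofReal_neg, Complex.ofReal_one, neg_mul, one_mul, sub_neg_eq_add]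
      ring
    have hker : ∀ v ∈ Set.Icc (-1 : ℝ) 0,
        ContinuousOn (fun z => (1 - (v : ℂ) * z)⁻¹) puncturedDisk :=
      fun v hv => ContinuousOn.inv₀ (by fun_prop) fun z hz => one_sub_mul_ne_zero hv hz
    have hGc : ContinuousOn G puncturedDisk := by
      have c1 := hker (r n) (hr' n)
      have c2 := hker (-1) (by norm_num)
      refine ContinuousOn.mul (ContinuousOn.div (by fun_prop) (by fun_prop) hne) ?_
      exact ((c1.sub c2).mul hJc).sub
        ((c1.const_mul (quadVal (r n) : ℂ)).sub (c2.const_mul (quadVal (-1) : ℂ)))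
    have hE := integral_energy_le hr hrlim hJd hJc hJ1 hJ0 n
    rw [bNormSq, one_div, inv_mul_le_iff₀ Real.two_pi_pos]
    refine le_of_eq_of_le (intervalIntegral.integral_congr_ae ?_) hE
    filter_upwards [ae_uc_ne_neg_one] with θ hθ _
    have hmem : uc θ ∈ puncturedDisk := mem_puncturedDisk.2 ⟨(norm_uc θ).le, hθ⟩
    have hJn : ‖J (uc θ)‖ = 1 := by
      rw [hJ, norm_mul, norm_uc, one_mul,
        norm_blaschke_eq_one hr' hblaschke hmem (norm_uc θ)]
    rw [bdry_eq_of_continuousWithinAt hEq (hGc _ hmem), energy, hJn, norm_sq_quad (norm_uc θ), hG,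
      norm_mul, norm_div]
    ring
  refine squeeze_zero (fun n => ?_) hbound ?_
  · exact mul_nonneg (by positivity)
      (intervalIntegral.integral_nonneg Real.two_pi_pos.le fun _ _ => sq_nonneg _)
  · have h := ((tendsto_quadKernel_self hrlim hr).add_const (3 / 2)).sub
      (((hrlim.div_const 2).const_sub 1).const_mul 2)
    norm_num at h
    exact h

end
end
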